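/- As polynomials in e and f, the leading term of P_{λ,μ}(e,f) (the coefficient of e^{|μ|}f^{|λ|}) equals 1/(h(λ)·h(μ)), i.e. the monomial e^{|μ|}f^{|λ|} appears with coefficient 1/(h(λ)h(μ)) and P_{λ,μ} has degree |μ| in e and |λ| in f. -/

import Mathlib

open scoped Classical BigOperators
noncomputable section

namespace ChernTensor

/-- The rectangular Young diagram with `r` rows each of length `c`. -/
def rect (r c : ℕ) : YoungDiagram :=
  ⟨Finset.range r ×ˢ Finset.range c, by
    intro p q hle hp
    simp only [Finset.coe_product, Set.mem_prod, Finset.mem_coe, Finset.mem_range] at hp ⊢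
    exact ⟨lt_of_le_of_lt hle.1 hp.1, lt_of_le_of_lt hle.2 hp.2⟩⟩

/-- The complement of a diagram `d` (rotated by 180°) inside the rectangle
with `r` rows and `c` columns. -/
def complIn (r c : ℕ) (d : YoungDiagram) : YoungDiagram :=
  ⟨(Finset.range r ×ˢ Finset.range c).filter
      (fun p => (r - 1 - p.1, c - 1 - p.2) ∉ d), by
    intro p q hle hp
    simp only [Finset.coe_filter, Set.mem_setOf_eq, Finset.mem_product,
      Finset.mem_range] at hp ⊢
    refine ⟨⟨lt_of_le_of_lt hle.1 hp.1.1, lt_of_le_of_lt hle.2 hp.1.2⟩, fun hq => hp.2 ?_⟩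
    exact d.isLowerSet (Prod.mk_le_mk.mpr ⟨Nat.sub_le_sub_left hle.1 _,
      Nat.sub_le_sub_left hle.2 _⟩) hq⟩

/-- The complement `e×f − ν̃ = (e − ν*_f, …, e − ν*_1)` of `ν` in the rectangle
with `f` rows each of length `e` (the paper's `e×f`). -/
def rectCompl (e f : ℕ) (ν : YoungDiagram) : YoungDiagram :=
  complIn f e ν.transpose

/-- The product of the hook lengths of all boxes of a Young diagram, as a rational. -/
def hookProd (ν : YoungDiagram) : ℚ :=
  ∏ c ∈ ν.cells, ((ν.rowLen c.1 + ν.colLen c.2 - c.1 - c.2 - 1 : ℕ) : ℚ)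

/-- The content polynomial `(n | ρ) = ∏_{(i,j) ∈ ρ} (n + j − i)` evaluated at `n`. -/
def contPoly (n : ℚ) (ρ : YoungDiagram) : ℚ :=
  ∏ c ∈ ρ.cells, (n + (c.2 : ℚ) - (c.1 : ℚ))

/-- The skew content polynomial `(n | ρ − σ) = ∏_{(i,j) ∈ ρ/σ} (n + j − i)`. -/
def skewContPoly (n : ℚ) (ρ σ : YoungDiagram) : ℚ :=
  ∏ c ∈ ρ.cells \ σ.cells, (n + (c.2 : ℚ) - (c.1 : ℚ))

/-- `T : ℕ×ℕ → ℕ` is a Littlewood–Richardson skew tableau of shape `ν/λ` and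
content `μ`: entries (≥ 1) exactly on the skew cells, rows weakly increasing,
columns strictly increasing, exactly `μ_k` entries equal to `k` (1-indexed),
and the reverse reading word is a lattice word. -/
def IsLRTableau (lam mu nu : YoungDiagram) (T : ℕ × ℕ → ℕ) : Prop :=
  (∀ c : ℕ × ℕ, c ∈ nu.cells \ lam.cells ↔ T c ≠ 0) ∧
  (∀ i j j', j ≤ j' → (i, j) ∈ nu.cells \ lam.cells → (i, j') ∈ nu.cells \ lam.cells →
    T (i, j) ≤ T (i, j')) ∧
  (∀ i i' j, i < i' → (i, j) ∈ nu.cells \ lam.cells → (i', j) ∈ nu.cells \ lam.cells →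
    T (i, j) < T (i', j)) ∧
  (∀ k : ℕ, ((nu.cells \ lam.cells).filter (fun c => T c = k + 1)).card = mu.rowLen k) ∧
  (∀ c ∈ nu.cells \ lam.cells, ∀ k : ℕ,
    (((nu.cells \ lam.cells).filter
        (fun d => (d.1 < c.1 ∨ (d.1 = c.1 ∧ c.2 ≤ d.2)) ∧ T d = k + 2)).card ≤
     ((nu.cells \ lam.cells).filter
        (fun d => (d.1 < c.1 ∨ (d.1 = c.1 ∧ c.2 ≤ d.2)) ∧ T d = k + 1)).card))

/-- The Littlewood–Richardson coefficient `c^ν_{λμ}`, defined as the number of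
Littlewood–Richardson skew tableaux of shape `ν/λ` and content `μ`. -/
def lrCoeff (lam mu nu : YoungDiagram) : ℕ :=
  if lam ≤ nu then Nat.card {T : ℕ × ℕ → ℕ // IsLRTableau lam mu nu T} else 0

/-- The universal coefficient `P_{λ,μ}(e,f) = ∑_ν c^{ν*}_{λ*,μ} (e|ν−λ)(f|ν*−μ)/h(ν)`. -/
def P (lam mu : YoungDiagram) (e f : ℚ) : ℚ :=
  ∑ᶠ nu : YoungDiagram, (lrCoeff lam.transpose mu nu.transpose : ℚ) *
    skewContPoly e nu lam * skewContPoly f nu.transpose mu / hookProd nu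

/-- A semistandard filling of the cells of `lam` with values in `Fin n`:
weakly increasing along rows, strictly increasing down columns. -/
def IsSSYT (lam : YoungDiagram) {n : ℕ} (T : lam.cells → Fin n) : Prop :=
  (∀ a b : lam.cells, (a : ℕ × ℕ).1 = (b : ℕ × ℕ).1 → (a : ℕ × ℕ).2 ≤ (b : ℕ × ℕ).2 →
    T a ≤ T b) ∧
  (∀ a b : lam.cells, (a : ℕ × ℕ).2 = (b : ℕ × ℕ).2 → (a : ℕ × ℕ).1 < (b : ℕ × ℕ).1 →
    T a < T b)

/-- The Schur polynomial `s_λ(x₁,…,x_n)` evaluated at `x`, as the generating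
function of semistandard tableaux. -/
def schur (lam : YoungDiagram) {n : ℕ} (x : Fin n → ℚ) : ℚ :=
  ∑ᶠ T : {T : lam.cells → Fin n // IsSSYT lam T}, ∏ c : lam.cells, x (T.1 c)

/-- The generalized binomial coefficient `C(a, b) = a(a−1)⋯(a−b+1)/b!`. -/
def gbinom (a : ℚ) (b : ℕ) : ℚ :=
  (∏ i ∈ Finset.range b, (a - i)) / (Nat.factorial b : ℚ)


/-- The reciprocal of the factorial, extended by zero to negative integers. -/
def invFactorial (z : ℤ) : ℚ := if z < 0 then 0 else 1 / (z.toNat.factorial : ℚ)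

/-- The determinant `det (1 / (p i - i + j)!)`. -/
def jacobiTrudi {N : ℕ} (p : Fin N → ℤ) : ℚ :=
  (Matrix.of fun i j : Fin N => invFactorial (p i - i + j)).det

lemma mul_invFactorial (z : ℤ) : (z : ℚ) * invFactorial z = invFactorial (z - 1) := by
  unfold invFactorial
  rcases lt_trichotomy z 0 with h | h | h
  · rw [if_pos h, if_pos (by omega)]; simp
  · subst h; simp
  · obtain ⟨n, rfl⟩ : ∃ n : ℕ, z = n + 1 := ⟨(z - 1).toNat, by omega⟩
    rw [if_neg (by omega), if_neg (by omega)]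
    have h1 : ((n : ℤ) + 1).toNat = n + 1 := by omega
    have h2 : ((n : ℤ) + 1 - 1).toNat = n := by omega
    rw [h1, h2, Nat.factorial_succ]
    have := Nat.factorial_ne_zero n
    push_cast
    field_simp

lemma sum_mul_jacobiTrudi {N : ℕ} (p : Fin N → ℤ) :
    ((∑ i, p i : ℤ) : ℚ) * jacobiTrudi p =
      ∑ i, jacobiTrudi (fun s => p s - if s = i then 1 else 0) := by
  simp only [jacobiTrudi, Matrix.det_apply', Matrix.of_apply]
  rw [Finset.sum_comm, Finset.mul_sum]
  refine Finset.sum_congr rfl fun σ _ => ?_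
  rw [← Finset.mul_sum, mul_left_comm]
  congr 1
  conv_rhs => rw [← Equiv.sum_comp σ]
  have key : (∑ i, p i : ℤ) = ∑ i, (p (σ i) - (σ i : ℕ) + (i : ℕ)) := by
    rw [Finset.sum_add_distrib, Finset.sum_sub_distrib, Equiv.sum_comp σ p,
      Equiv.sum_comp σ (fun i : Fin N => ((i : ℕ) : ℤ))]
    ring
  rw [key, Int.cast_sum, Finset.sum_mul]
  refine Finset.sum_congr rfl fun i _ => ?_
  rw [← Finset.mul_prod_erase _ _ (Finset.mem_univ i), ← mul_assoc, mul_invFactorial,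
    ← Finset.mul_prod_erase _ _ (Finset.mem_univ i)]
  congr 1
  · congr 1; simp; ring
  · refine Finset.prod_congr rfl fun j hj => ?_
    have : σ j ≠ σ i := fun h => (Finset.ne_of_mem_erase hj) (σ.injective h)
    simp [this]

lemma jacobiTrudi_sub_eq_zero {N : ℕ} (p : ℕ → ℕ) (i : Fin N) (hN : ∀ s, N ≤ s → p s = 0)
    (hi : p i = p (i + 1)) :
    jacobiTrudi (fun s : Fin N => (p s : ℤ) - if s = i then 1 else 0) = 0 := by
  by_cases h : (i : ℕ) + 1 < N
  · refine Matrix.det_zero_of_row_eq (i := i) (j := ⟨i + 1, h⟩)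
      (by intro e; have := congrArg Fin.val e; simp at this) ?_
    ext j
    have : (⟨(i : ℕ) + 1, h⟩ : Fin N) ≠ i := by intro e; have := congrArg Fin.val e; simp at this
    simp only [Matrix.of_apply, if_true, this, if_false, hi]
    congr 1; push_cast; ring
  · refine Matrix.det_eq_zero_of_row_eq_zero i fun j => ?_
    rw [hN (i + 1) (by omega)] at hi
    simp only [Matrix.of_apply, if_true, hi, invFactorial]
    rw [if_pos]; have := j.2; push_cast; omega

lemma invFactorial_sub_eq (l j : ℕ) :
    invFactorial ((l : ℤ) - j) = 1 / (l.factorial : ℚ) * ((descPochhammer ℚ j).eval (l : ℚ)) := by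
  rw [descPochhammer_eval_eq_descFactorial]
  unfold invFactorial
  split_ifs with h
  · rw [Nat.descFactorial_eq_zero_iff_lt.2 (by omega)]; simp
  · have e : ((l : ℤ) - j).toNat = l - j := by omega
    have h1 := Nat.factorial_mul_descFactorial (show j ≤ l by omega)
    have h2 := Nat.factorial_ne_zero l
    have h3 := Nat.factorial_ne_zero (l - j)
    rw [e, ← h1]
    rw [← h1] at h2
    push_cast
    have h4 : ((l.descFactorial j : ℕ) : ℚ) ≠ 0 := by
      intro h; exact h2 (by rw [Nat.cast_eq_zero.1 h, mul_zero])
    have h5 : (((l - j).factorial : ℕ) : ℚ) ≠ 0 := by exact_mod_cast h3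
    field_simp

lemma jacobiTrudi_eq_prod {N : ℕ} (p : ℕ → ℕ) :
    jacobiTrudi (fun s : Fin N => (p s : ℤ)) =
      ∏ i : Fin N, (1 / ((p i + (N - 1 - i)).factorial : ℚ) *
        ∏ k ∈ Finset.Ioi i, (((p i + (N - 1 - i) : ℕ) : ℚ) - ((p k + (N - 1 - k) : ℕ) : ℚ))) := by
  have h1 : jacobiTrudi (fun s : Fin N => (p s : ℤ)) =
      (Matrix.of fun i j : Fin N =>
        (1 / ((p (Fin.rev i) + (N - 1 - Fin.rev i)).factorial : ℚ)) *
          (Matrix.of fun i j : Fin N => (descPochhammer ℚ (j : ℕ)).eval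
            ((p (Fin.rev i) + (N - 1 - Fin.rev i) : ℕ) : ℚ)) i j).det := by
    unfold jacobiTrudi
    rw [← Matrix.det_submatrix_equiv_self Fin.revPerm]
    congr 1
    ext i j
    simp only [Matrix.submatrix_apply, Matrix.of_apply, Fin.revPerm_apply, ← invFactorial_sub_eq]
    congr 1
    have := i.2
    have := j.2
    simp only [Fin.val_rev]
    push_cast
    omega
  rw [h1, Matrix.det_mul_column, ← Matrix.det_eval_matrixOfPolynomials_eq_det_vandermonde
    (fun i : Fin N => ((p (Fin.rev i) + (N - 1 - Fin.rev i) : ℕ) : ℚ))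
    (fun j => descPochhammer ℚ j) (fun i => descPochhammer_natDegree ℚ i)
    (fun i => monic_descPochhammer ℚ i), Matrix.det_vandermonde, Finset.prod_mul_distrib]
  congr 1
  · exact Equiv.prod_comp Fin.revPerm
      (fun i : Fin N => (1 / ((p i + (N - 1 - i)).factorial : ℚ)))
  · rw [Finset.prod_sigma', Finset.prod_sigma']
    refine Finset.prod_bij' (fun x _ => ⟨Fin.rev x.2, Fin.rev x.1⟩)
      (fun x _ => ⟨Fin.rev x.2, Fin.rev x.1⟩) ?_ ?_ ?_ ?_ ?_ <;> simp

lemma hookProd_row (ν : YoungDiagram) {N : ℕ} (hN : ν.colLen 0 ≤ N) (i : Fin N) :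
    (∏ j ∈ Finset.range (ν.rowLen i),
        ((ν.rowLen i + ν.colLen j - i - j - 1 : ℕ) : ℚ)) *
      ∏ k ∈ Finset.Ioi i, (((ν.rowLen i + (N - 1 - i) : ℕ) : ℚ) -
        ((ν.rowLen k + (N - 1 - k) : ℕ) : ℚ)) =
      ((ν.rowLen i + (N - 1 - i)).factorial : ℚ) := by
  have hi := i.2
  have hcol : ∀ j, ν.colLen j ≤ N := fun j => (ν.colLen_anti 0 j (Nat.zero_le _)).trans hN
  have hmem : ∀ a b, a < ν.colLen b ↔ b < ν.rowLen a := fun a b => by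
    rw [← YoungDiagram.mem_iff_lt_colLen, ← YoungDiagram.mem_iff_lt_rowLen]
  have hA : ∀ a b, a ≤ b → ν.rowLen b ≤ ν.rowLen a := fun a b h => ν.rowLen_anti a b h
  have hB : ∀ a b, a ≤ b → ν.colLen b ≤ ν.colLen a := fun a b h => ν.colLen_anti a b h
  set f : ℕ → ℕ := fun j => ν.rowLen i + ν.colLen j - i - j - 1 with hf
  set g : Fin N → ℕ := fun k => ν.rowLen i + (N - 1 - i) - (ν.rowLen k + (N - 1 - k)) with hg
  have hle : ∀ k ∈ Finset.Ioi i, ν.rowLen k + (N - 1 - k) < ν.rowLen i + (N - 1 - i) := by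
    intro k hk
    have h1 : i < k := Finset.mem_Ioi.1 hk
    have h1 : (i : ℕ) < k := h1
    have := hA i k h1.le
    have := k.2
    omega
  have hprod : ∏ k ∈ Finset.Ioi i, (((ν.rowLen i + (N - 1 - i) : ℕ) : ℚ) -
        ((ν.rowLen k + (N - 1 - k) : ℕ) : ℚ)) = ∏ k ∈ Finset.Ioi i, (g k : ℚ) :=
    Finset.prod_congr rfl fun k hk => (Nat.cast_sub (hle k hk).le).symm
  have finj : Set.InjOn f (Finset.range (ν.rowLen i)) := by
    intro a ha b hb h
    simp only [Finset.coe_range, Set.mem_Iio] at ha hb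
    have h1 := (hmem i a).2 ha
    have h2 := (hmem i b).2 hb
    simp only [hf] at h
    rcases lt_trichotomy a b with hab | hab | hab
    · have := hB a b hab.le; omega
    · exact hab
    · have := hB b a hab.le; omega
  have ginj : Set.InjOn g (Finset.Ioi i) := by
    intro a ha b hb h
    have ha' := hle a ha
    have hb' := hle b hb
    have := a.2
    have := b.2
    simp only [hg] at h
    ext
    rcases lt_trichotomy (a : ℕ) b with hab | hab | hab
    · have := hA a b hab.le; omega
    · exact hab
    · have := hA b a hab.le; omega
  have hdisj : Disjoint ((Finset.range (ν.rowLen i)).image f) ((Finset.Ioi i).image g) := by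
    rw [Finset.disjoint_left]
    intro x hx hy
    obtain ⟨j, hj, rfl⟩ := Finset.mem_image.1 hx
    obtain ⟨k, hk, h⟩ := Finset.mem_image.1 hy
    have hj := Finset.mem_range.1 hj
    have h1 := (hmem i j).2 hj
    have h2 := hle k hk
    have := k.2
    have h3 := hmem k j
    simp only [hf, hg] at h
    by_cases hc : (k : ℕ) < ν.colLen j
    · have := h3.1 hc; omega
    · have : ¬ j < ν.rowLen k := fun h => hc (h3.2 h)
      omega
  have hun : (Finset.range (ν.rowLen i)).image f ∪ (Finset.Ioi i).image g =
      Finset.Ico 1 (ν.rowLen i + (N - 1 - i) + 1) := by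
    refine Finset.eq_of_subset_of_card_le ?_ ?_
    · intro x hx
      rw [Finset.mem_Ico]
      rcases Finset.mem_union.1 hx with hx | hx
      · obtain ⟨j, hj, rfl⟩ := Finset.mem_image.1 hx
        have hj := Finset.mem_range.1 hj
        have h1 := (hmem i j).2 hj
        have := hcol j
        simp only [hf]; omega
      · obtain ⟨k, hk, rfl⟩ := Finset.mem_image.1 hx
        have := hle k hk
        simp only [hg]; omega
    · rw [Finset.card_union_of_disjoint hdisj, Finset.card_image_of_injOn finj,
        Finset.card_image_of_injOn ginj]
      simp
  rw [hprod, ← Nat.cast_prod, ← Nat.cast_prod, ← Nat.cast_mul, ← Finset.prod_Ico_id_eq_factorial,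
    ← hun, Finset.prod_union hdisj, Finset.prod_image finj, Finset.prod_image ginj]

lemma jacobiTrudi_rowLen (ν : YoungDiagram) {N : ℕ} (hN : ν.colLen 0 ≤ N) :
    jacobiTrudi (fun s : Fin N => (ν.rowLen s : ℤ)) = 1 / hookProd ν := by
  have hprod : hookProd ν = ∏ i : Fin N, ∏ j ∈ Finset.range (ν.rowLen i),
        ((ν.rowLen i + ν.colLen j - i - j - 1 : ℕ) : ℚ) := by
    rw [Finset.prod_sigma']
    unfold hookProd
    symm
    refine Finset.prod_bij (fun x _ => ((x.1 : ℕ), x.2)) ?_ ?_ ?_ ?_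
    · rintro ⟨i, j⟩ h
      simpa [YoungDiagram.mem_iff_lt_rowLen] using h
    · rintro ⟨i, j⟩ _ ⟨i', j'⟩ _ h
      simp only [Prod.mk.injEq] at h
      obtain ⟨h1, rfl⟩ := h
      obtain rfl := Fin.ext h1
      rfl
    · rintro ⟨i, j⟩ h
      have h1 : (i, j) ∈ ν := h
      have h2 := YoungDiagram.mem_iff_lt_colLen.1 h1
      have h3 := ν.colLen_anti 0 j (Nat.zero_le _)
      exact ⟨⟨⟨i, by omega⟩, j⟩, by simpa [YoungDiagram.mem_iff_lt_rowLen] using h1, rfl⟩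
    · intro _ _; rfl
  rw [jacobiTrudi_eq_prod (fun s => ν.rowLen s), hprod, one_div, ← Finset.prod_inv_distrib]
  refine Finset.prod_congr rfl fun i _ => ?_
  have h1 := hookProd_row ν hN i
  have h2 : ((ν.rowLen i + (N - 1 - i)).factorial : ℚ) ≠ 0 := by
    exact_mod_cast Nat.factorial_ne_zero _
  have h3 : ∏ j ∈ Finset.range (ν.rowLen i),
        ((ν.rowLen i + ν.colLen j - i - j - 1 : ℕ) : ℚ) ≠ 0 := by
    intro h; rw [h, zero_mul] at h1; exact h2 h1.symm
  rw [← h1] at h2 ⊢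
  rw [one_div, mul_inv, mul_assoc, inv_mul_cancel₀ (right_ne_zero_of_mul h2), mul_one]

lemma hookProd_ne_zero (ν : YoungDiagram) : hookProd ν ≠ 0 := by
  refine Finset.prod_ne_zero_iff.2 ?_
  rintro ⟨i, j⟩ h
  have h1 : (i, j) ∈ ν := h
  have h2 := YoungDiagram.mem_iff_lt_colLen.1 h1
  have h3 := YoungDiagram.mem_iff_lt_rowLen.1 h1
  rw [Nat.cast_ne_zero]
  simp only
  omega

lemma hookProd_transpose (ν : YoungDiagram) : hookProd ν.transpose = hookProd ν := by
  unfold hookProd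
  refine Finset.prod_bij (fun x _ => x.swap) ?_ ?_ ?_ ?_
  · intro x hx
    exact YoungDiagram.mem_transpose.1 hx
  · intro x _ y _ h
    exact Prod.swap_injective h
  · intro x hx
    exact ⟨x.swap, by simpa using hx, by simp⟩
  · rintro ⟨i, j⟩ _
    simp only [YoungDiagram.rowLen_transpose, YoungDiagram.colLen_transpose, Prod.fst_swap,
      Prod.snd_swap]
    congr 1
    omega

/-- The number of boxes in the first `i` rows of the shape with row lengths `p`. -/
def rowSum (p : ℕ → ℕ) (i : ℕ) : ℕ := ∑ s ∈ Finset.range i, p s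

lemma rowSum_succ (p : ℕ → ℕ) (i : ℕ) : rowSum p (i + 1) = rowSum p i + p i :=
  Finset.sum_range_succ _ _

/-- A Littlewood–Richardson pattern: a chain of shapes `g 0 = lam ⊆ g 1 ⊆ ⋯` with at most `N` rows,
in which `g (k + 1) / g k` is a horizontal strip of size `mu k`, and these strips satisfy the
lattice condition. -/
structure IsPattern (N : ℕ) (lam mu : ℕ → ℕ) (g : ℕ → ℕ → ℕ) : Prop where
  zero : g 0 = lam
  le : ∀ k s, g k s ≤ g (k + 1) s
  strip : ∀ k s, g (k + 1) (s + 1) ≤ g k s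
  content : ∀ k, rowSum (g (k + 1)) N = rowSum (g k) N + mu k
  lattice : ∀ k i, rowSum (g (k + 2)) (i + 1) + rowSum (g k) i ≤
    rowSum (g (k + 1)) (i + 1) + rowSum (g (k + 1)) i
  supp : ∀ k s, N ≤ s → g k s = 0

/-- A removal path of a pattern: `r k < N` is the row in which the `k`-th shape loses a box, while
`r k = N` means that the `k`-th shape does not change. -/
structure IsPath (N : ℕ) (g : ℕ → ℕ → ℕ) (r : ℕ → ℕ) : Prop where
  anti : ∀ k, r (k + 1) ≤ r k
  le : ∀ k, r k ≤ N
  corner : ∀ k, r k < N → g (k + 1) (r k + 1) < g k (r k)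
  chain : ∀ k s, r (k + 1) ≤ s → s < r k → g (k + 1) (s + 1) = g k s
  const : ∀ k, N ≤ k → r k = r N
  lt : r N < N

/-- An insertion path of a pattern, the notion inverse to `IsPath`. -/
structure IsCopath (N : ℕ) (g : ℕ → ℕ → ℕ) (r : ℕ → ℕ) : Prop where
  anti : ∀ k, r (k + 1) ≤ r k
  le : ∀ k, r k ≤ N
  cocorner : ∀ k, r (k + 1) < N → 0 < r (k + 1) → g (k + 1) (r (k + 1)) < g k (r (k + 1) - 1)
  chain : ∀ k s, r (k + 1) ≤ s → s < r k → g (k + 1) (s + 1) = g k s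
  const : ∀ k, N ≤ k → r k = r N
  lt : r N < N

/-- `g` arises from `g'` by adding a box in row `r k` to the `k`-th shape whenever `r k < N`. -/
def AddsBoxes (N : ℕ) (g g' : ℕ → ℕ → ℕ) (r : ℕ → ℕ) : Prop :=
  ∀ k s, g k s = g' k s + if s = r k ∧ r k < N then 1 else 0

lemma AddsBoxes.rowSum {N : ℕ} {g g' : ℕ → ℕ → ℕ} {r : ℕ → ℕ} (h : AddsBoxes N g g' r)
    (k i : ℕ) : rowSum (g k) i = rowSum (g' k) i + if r k < i ∧ r k < N then 1 else 0 := by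
  induction i with
  | zero => simp [ChernTensor.rowSum]
  | succ i ih =>
    rw [rowSum_succ, rowSum_succ, ih, h k i]
    split_ifs <;> omega

lemma IsPattern.anti {N : ℕ} {lam mu : ℕ → ℕ} {g : ℕ → ℕ → ℕ} (hg : IsPattern N lam mu g)
    (k s : ℕ) : g k (s + 1) ≤ g k s :=
  (hg.le k (s + 1)).trans (hg.strip k s)

lemma IsPattern.lattice_lt_of_path {N : ℕ} {lam mu : ℕ → ℕ} {g : ℕ → ℕ → ℕ} {r : ℕ → ℕ}
    (hg : IsPattern N lam mu g) (hr : IsPath N g r) (k i : ℕ) (h1 : r (k + 1) < i)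
    (h2 : i ≤ r k ∨ r k = N) (h3 : r (k + 1) < r k) :
    rowSum (g (k + 2)) (i + 1) + rowSum (g k) i <
      rowSum (g (k + 1)) (i + 1) + rowSum (g (k + 1)) i := by
  have hN := hr.le k
  induction i, h1 using Nat.le_induction with
  | base =>
    have := hr.corner (k + 1) (by omega)
    have := hr.chain k (r (k + 1)) le_rfl (by omega)
    have := hg.lattice k (r (k + 1))
    have e1 := rowSum_succ (g (k + 2)) (r (k + 1) + 1)
    have e2 := rowSum_succ (g k) (r (k + 1))
    have e3 := rowSum_succ (g (k + 1)) (r (k + 1) + 1)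
    have e4 := rowSum_succ (g (k + 1)) (r (k + 1))
    simp only [Nat.succ_eq_add_one, add_assoc, Nat.reduceAdd] at *
    omega
  | succ i hi ih =>
    have := ih (by omega)
    have hs : i < r k → g (k + 1) (i + 1) = g k i := hr.chain k i (by omega)
    have hz : N ≤ i → g (k + 1) (i + 1) = 0 ∧ g k i = 0 := fun h =>
      ⟨hg.supp _ _ (by omega), hg.supp _ _ h⟩
    have := hg.strip (k + 1) i
    have := hg.anti (k + 1) i
    have : N ≤ i → g (k + 1) i = 0 := hg.supp _ _
    have e1 := rowSum_succ (g (k + 2)) (i + 1)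
    have e2 := rowSum_succ (g k) i
    have e3 := rowSum_succ (g (k + 1)) (i + 1)
    have e4 := rowSum_succ (g (k + 1)) i
    simp only [Nat.succ_eq_add_one, add_assoc, Nat.reduceAdd] at *
    omega

lemma IsPattern.rowSum_eq {N : ℕ} {lam mu : ℕ → ℕ} {g : ℕ → ℕ → ℕ} (hg : IsPattern N lam mu g)
    (k i : ℕ) (hi : N ≤ i) : rowSum (g k) i = rowSum (g k) N := by
  induction i, hi using Nat.le_induction with
  | base => rfl
  | succ i hi ih => rw [rowSum_succ, ih, hg.supp k i hi, add_zero]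

lemma IsPattern.lattice_lt_of_copath {N : ℕ} {lam mu : ℕ → ℕ} {g : ℕ → ℕ → ℕ} {r : ℕ → ℕ}
    (hg : IsPattern N lam mu g) (hr : IsCopath N g r) (k i : ℕ) (h1 : r (k + 2) ≤ i)
    (h2 : i < r (k + 1) ∨ r (k + 1) = N) (h3 : r (k + 1) < N ∨ mu (k + 1) < mu k) :
    rowSum (g (k + 2)) (i + 1) + rowSum (g k) i <
      rowSum (g (k + 1)) (i + 1) + rowSum (g (k + 1)) i := by
  have step : ∀ i, r (k + 2) ≤ i → i < r (k + 1) →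
      g (k + 2) (i + 1) = g (k + 1) i := fun i h h' => hr.chain (k + 1) i h h'
  have high : r (k + 1) = N → ∀ i, N ≤ i → rowSum (g (k + 2)) (i + 1) + rowSum (g k) i <
      rowSum (g (k + 1)) (i + 1) + rowSum (g (k + 1)) i := by
    intro h i hi
    rw [hg.rowSum_eq _ _ hi, hg.rowSum_eq _ _ hi, hg.rowSum_eq _ (i + 1) (by omega),
      hg.rowSum_eq _ (i + 1) (by omega)]
    have := hg.content k
    have := hg.content (k + 1)
    simp only [add_assoc, Nat.reduceAdd] at *
    omega
  by_cases hi : N ≤ i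
  · have := hr.le (k + 1)
    exact high (by omega) i hi
  have hlt : i < r (k + 1) := by omega
  obtain ⟨d, hd⟩ : ∃ d, r (k + 1) = i + 1 + d := ⟨r (k + 1) - (i + 1), by omega⟩
  clear h2 hi
  induction d generalizing i with
  | zero =>
    have s1 := step i h1 hlt
    have e1 := rowSum_succ (g (k + 2)) (i + 1)
    have e2 := rowSum_succ (g k) i
    have e3 := rowSum_succ (g (k + 1)) (i + 1)
    have e4 := rowSum_succ (g (k + 1)) i
    simp only [add_zero] at hd
    rcases h3 with h3 | h3
    · have := hr.cocorner k h3 (by omega)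
      have := hg.lattice k (i + 1)
      simp only [hd, add_assoc, Nat.reduceAdd, Nat.add_sub_cancel] at *
      omega
    · have := hg.strip k i
      have hle := hr.le (k + 1)
      by_cases h : r (k + 1) = N
      · have := high h (i + 1) (by omega)
        simp only [hd, add_assoc, Nat.reduceAdd] at *
        omega
      · have := hr.cocorner k (by omega) (by omega)
        have := hg.lattice k (i + 1)
        simp only [hd, add_assoc, Nat.reduceAdd, Nat.add_sub_cancel] at *
        omega
  | succ d ih =>
    have := ih (i + 1) (by omega) (by omega) (by omega)
    have := step i h1 hlt
    have := hg.strip k i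
    have e1 := rowSum_succ (g (k + 2)) (i + 1)
    have e2 := rowSum_succ (g k) i
    have e3 := rowSum_succ (g (k + 1)) (i + 1)
    have e4 := rowSum_succ (g (k + 1)) i
    simp only [add_assoc, Nat.reduceAdd] at *
    omega

lemma IsPattern.remove {N : ℕ} {lam mu lam' mu' : ℕ → ℕ} {g g' : ℕ → ℕ → ℕ} {r : ℕ → ℕ}
    (hg : IsPattern N lam mu g) (hr : IsPath N g r) (h : AddsBoxes N g g' r) (h0 : g' 0 = lam')
    (hmu : ∀ k, mu k + (if r k < N then 1 else 0) = mu' k + if r (k + 1) < N then 1 else 0) :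
    IsPattern N lam' mu' g' ∧ IsCopath N g' r := by
  refine ⟨⟨h0, ?_, ?_, ?_, ?_, ?_⟩, ⟨hr.anti, hr.le, ?_, ?_, hr.const, hr.lt⟩⟩
  · intro k s
    have h1 := h k s
    have h2 := h (k + 1) s
    have := hg.le k s
    have := hr.anti k
    have := hr.le k
    by_cases hs : s = r (k + 1) ∧ r (k + 1) < N
    · obtain ⟨rfl, hs⟩ := hs
      by_cases hk : r (k + 1) = r k
      · rw [if_pos ⟨rfl, hs⟩] at h2
        rw [if_pos ⟨hk, by omega⟩] at h1
        omega
      · rw [if_pos ⟨rfl, hs⟩] at h2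
        have := hr.chain k _ le_rfl (by omega)
        have := hr.corner (k + 1) hs
        have := hg.le (k + 1) (r (k + 1) + 1)
        omega
    · rw [if_neg hs] at h2
      omega
  · intro k s
    have h1 := h k s
    have h2 := h (k + 1) (s + 1)
    have := hg.strip k s
    by_cases hs : s = r k ∧ r k < N
    · have := hr.corner k hs.2
      rw [if_pos hs, hs.1] at h1
      rw [hs.1] at h2 ⊢
      omega
    · rw [if_neg hs] at h1; omega
  · intro k
    have h1 := h.rowSum k N
    have h2 := h.rowSum (k + 1) N
    have := hg.content k
    have := hmu k
    simp only [and_self] at h1 h2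
    omega
  · intro k i
    have e1 := h.rowSum (k + 2) (i + 1)
    have e2 := h.rowSum k i
    have e3 := h.rowSum (k + 1) (i + 1)
    have e4 := h.rowSum (k + 1) i
    have := hg.lattice k i
    have a1 := hr.anti k
    have a2 : r (k + 2) ≤ r (k + 1) := hr.anti (k + 1)
    have l1 := hr.le k
    by_cases hc : r (k + 1) < i ∧ r (k + 1) < r k ∧ (i ≤ r k ∨ r k = N)
    · have := hg.lattice_lt_of_path hr k i hc.1 hc.2.2 hc.2.1
      split_ifs at e1 e2 e3 e4 <;> omega
    · split_ifs at e1 e2 e3 e4 <;> omega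
  · intro k s hs
    have := h k s
    rw [hg.supp k s hs] at this
    omega
  · intro k h1 h2
    have e1 := h (k + 1) (r (k + 1))
    have e2 := h k (r (k + 1) - 1)
    have hs := hg.strip k (r (k + 1) - 1)
    have := hr.anti k
    rw [if_pos ⟨rfl, h1⟩] at e1
    rw [if_neg (by omega)] at e2
    rw [Nat.sub_add_cancel h2] at hs
    omega
  · intro k s h1 h2
    have e1 := h (k + 1) (s + 1)
    have e2 := h k s
    have := hr.chain k s h1 h2
    rw [if_neg (by omega)] at e1
    rw [if_neg (by omega)] at e2
    omega

lemma IsPattern.insert {N : ℕ} {lam mu lam' mu' : ℕ → ℕ} {g g' : ℕ → ℕ → ℕ} {r : ℕ → ℕ}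
    (hg : IsPattern N lam' mu' g') (hr : IsCopath N g' r) (h : AddsBoxes N g g' r) (h0 : g 0 = lam)
    (hmu : ∀ k, mu k + (if r k < N then 1 else 0) = mu' k + if r (k + 1) < N then 1 else 0)
    (hlam : r 0 < N → 0 < r 0 → lam' (r 0) < lam' (r 0 - 1))
    (hexit : ∀ k, r (k + 1) = N → r (k + 2) < N → mu' (k + 1) < mu' k) :
    IsPattern N lam mu g ∧ IsPath N g r := by
  have hco : ∀ k, r k < N → 0 < r k → g' k (r k) < g' k (r k - 1) := by
    intro k h1 h2
    cases k with
    | zero => rw [hg.zero]; exact hlam h1 h2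
    | succ k => exact (hr.cocorner k h1 h2).trans_le (hg.le _ _)
  refine ⟨⟨h0, ?_, ?_, ?_, ?_, ?_⟩, ⟨hr.anti, hr.le, ?_, ?_, hr.const, hr.lt⟩⟩
  · intro k s
    have h1 := h k s
    have h2 := h (k + 1) s
    have := hg.le k s
    have := hr.anti k
    by_cases hs : s = r k ∧ r k < N
    · obtain ⟨rfl, hs⟩ := hs
      rw [if_pos ⟨rfl, hs⟩] at h1
      by_cases hk : r (k + 1) = r k
      · rw [if_pos ⟨hk.symm, by omega⟩] at h2
        omega
      · have := hr.chain k (r k - 1) (by omega) (by omega)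
        have := hco k hs (by omega)
        rw [Nat.sub_add_cancel (by omega)] at *
        omega
    · rw [if_neg hs] at h1
      omega
  · intro k s
    have h1 := h k s
    have h2 := h (k + 1) (s + 1)
    have := hg.strip k s
    by_cases hs : s + 1 = r (k + 1) ∧ r (k + 1) < N
    · have := hr.cocorner k hs.2 (by omega)
      rw [if_pos hs] at h2
      rw [← hs.1, Nat.add_sub_cancel] at this
      omega
    · rw [if_neg hs] at h2; omega
  · intro k
    have h1 := h.rowSum k N
    have h2 := h.rowSum (k + 1) N
    have := hg.content k
    have := hmu k
    simp only [and_self] at h1 h2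
    omega
  · intro k i
    have e1 := h.rowSum (k + 2) (i + 1)
    have e2 := h.rowSum k i
    have e3 := h.rowSum (k + 1) (i + 1)
    have e4 := h.rowSum (k + 1) i
    have := hg.lattice k i
    have a1 := hr.anti k
    have a2 : r (k + 2) ≤ r (k + 1) := hr.anti (k + 1)
    have l1 := hr.le k
    have l2 := hr.le (k + 1)
    by_cases hc : r (k + 2) ≤ i ∧ r (k + 2) < N ∧ (i < r (k + 1) ∨ r (k + 1) = N)
    · have := hg.lattice_lt_of_copath hr k i hc.1 hc.2.2 (by
        by_cases hk : r (k + 1) = N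
        · exact Or.inr (hexit k hk hc.2.1)
        · omega)
      split_ifs at e1 e2 e3 e4 <;> omega
    · split_ifs at e1 e2 e3 e4 <;> omega
  · intro k s hs
    have := h k s
    rw [hg.supp k s hs, if_neg (by omega)] at this
    omega
  · intro k hk
    have e1 := h (k + 1) (r k + 1)
    have e2 := h k (r k)
    have := hg.strip k (r k)
    have := hr.anti k
    rw [if_neg (by omega)] at e1
    rw [if_pos ⟨rfl, hk⟩] at e2
    omega
  · intro k s h1 h2
    have e1 := h (k + 1) (s + 1)
    have e2 := h k s
    have := hr.chain k s h1 h2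
    have := hr.le k
    rw [if_neg (by omega)] at e1
    rw [if_neg (by omega)] at e2
    omega

lemma IsPath.unique {N : ℕ} {g : ℕ → ℕ → ℕ} {r r' : ℕ → ℕ} (hr : IsPath N g r)
    (hr' : IsPath N g r') (h : r N = r' N) : r = r' := by
  have step : ∀ k, r (k + 1) = r' (k + 1) → r k = r' k := by
    intro k hk
    have := hr.anti k
    have := hr'.anti k
    have := hr.le k
    have := hr'.le k
    rcases lt_trichotomy (r k) (r' k) with hlt | heq | hlt
    · have := hr.corner k (by omega)
      have := hr'.chain k (r k) (by omega) hlt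
      omega
    · exact heq
    · have := hr'.corner k (by omega)
      have := hr.chain k (r' k) (by omega) hlt
      omega
  have low : ∀ d k, k + d = N → r k = r' k := by
    intro d
    induction d with
    | zero => intro k hk; rw [add_zero] at hk; rw [hk, h]
    | succ d ih => intro k hk; exact step k (ih (k + 1) (by omega))
  funext k
  rcases le_total N k with hk | hk
  · rw [hr.const k hk, hr'.const k hk, h]
  · exact low (N - k) k (by omega)

lemma IsCopath.unique {N : ℕ} {g : ℕ → ℕ → ℕ} {r r' : ℕ → ℕ} (hr : IsCopath N g r)
    (hr' : IsCopath N g r') (h : r 0 = r' 0) (hN : ∀ k, r k < N ↔ r' k < N) : r = r' := by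
  funext k
  induction k with
  | zero => exact h
  | succ k ih =>
    have := hr.anti k
    have := hr'.anti k
    have := hr.le (k + 1)
    have := hr'.le (k + 1)
    have := hN (k + 1)
    rcases lt_trichotomy (r (k + 1)) (r' (k + 1)) with hlt | heq | hlt
    · have h1 := hr'.cocorner k (by omega) (by omega)
      have h2 := hr.chain k (r' (k + 1) - 1) (by omega) (by omega)
      rw [Nat.sub_add_cancel (by omega)] at h2
      omega
    · exact heq
    · have h1 := hr.cocorner k (by omega) (by omega)
      have h2 := hr'.chain k (r (k + 1) - 1) (by omega) (by omega)
      rw [Nat.sub_add_cancel (by omega)] at h2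
      omega

lemma IsPattern.succ_eq {N : ℕ} {lam mu : ℕ → ℕ} {g : ℕ → ℕ → ℕ} (hg : IsPattern N lam mu g)
    {k : ℕ} (hk : mu k = 0) : g (k + 1) = g k := by
  have h := hg.content k
  rw [hk, add_zero] at h
  have h1 := (Finset.sum_eq_sum_iff_of_le (fun s _ => hg.le k s)).1 h.symm
  funext s
  by_cases hs : s < N
  · exact (h1 s (Finset.mem_range.2 hs)).symm
  · rw [hg.supp _ _ (by omega), hg.supp _ _ (by omega)]

lemma IsPattern.const {N : ℕ} {lam mu : ℕ → ℕ} {g : ℕ → ℕ → ℕ} (hg : IsPattern N lam mu g)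
    (hmu : ∀ k, N ≤ k → mu k = 0) (k : ℕ) (hk : N ≤ k) : g k = g N := by
  induction k, hk using Nat.le_induction with
  | base => rfl
  | succ k hk ih => rw [hg.succ_eq (hmu k hk), ih]

lemma IsPattern.exists_path {N : ℕ} {lam mu : ℕ → ℕ} {g : ℕ → ℕ → ℕ} (hg : IsPattern N lam mu g)
    (hmu : ∀ k, N ≤ k → mu k = 0) {i : ℕ} (hi : i < N) (hc : g N (i + 1) < g N i) :
    ∃ r, IsPath N g r ∧ r N = i := by
  have hex : ∀ k j : ℕ, ∃ s, j ≤ s ∧ (N ≤ s ∨ g (k + 1) (s + 1) < g k s) ∧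
      ∀ m, j ≤ m → m < s → m < N ∧ g k m ≤ g (k + 1) (m + 1) := by
    intro k j
    have h : ∃ s, j ≤ s ∧ (N ≤ s ∨ g (k + 1) (s + 1) < g k s) :=
      ⟨max j N, le_max_left _ _, Or.inl (le_max_right _ _)⟩
    refine ⟨Nat.find h, (Nat.find_spec h).1, (Nat.find_spec h).2, fun m hm hlt => ?_⟩
    have := Nat.find_min h hlt
    omega
  choose next hle hnext hmin using hex
  let R : ℕ → ℕ := fun d => Nat.rec i (fun d j => next (N - (d + 1)) j) d
  have hR : ∀ d, R (d + 1) = next (N - (d + 1)) (R d) := fun _ => rfl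
  have hRN : ∀ d, R d ≤ N := by
    intro d
    induction d with
    | zero => exact hi.le
    | succ d ih =>
      rw [hR]
      by_contra hlt
      exact lt_irrefl _ (hmin _ _ N ih (not_le.1 hlt)).1
  have hlow : ∀ k, k < N → R (N - k) = next k (R (N - (k + 1))) := by
    intro k hk
    have e : N - k = N - (k + 1) + 1 := by omega
    have e' : N - (N - (k + 1) + 1) = k := by omega
    rw [e, hR, e']
  have hhigh : ∀ k, N ≤ k → R (N - k) = i := by
    intro k hk
    rw [Nat.sub_eq_zero_of_le hk]
    rfl
  refine ⟨fun k => R (N - k), ⟨?_, fun k => hRN _, ?_, ?_, ?_, ?_⟩, hhigh N le_rfl⟩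
  · intro k
    by_cases hk : k < N
    · simp only [hlow k hk]
      exact hle _ _
    · rw [hhigh k (by omega), hhigh (k + 1) (by omega)]
  · intro k h
    by_cases hk : k < N
    · simp only [hlow k hk] at h ⊢
      exact (hnext k (R (N - (k + 1)))).resolve_left (by omega)
    · rw [hhigh k (by omega), hg.const hmu k (by omega), hg.const hmu (k + 1) (by omega)]
      exact hc
  · intro k s h1 h2
    by_cases hk : k < N
    · simp only [hlow k hk] at h2
      exact le_antisymm (hg.strip k s) (hmin _ _ s h1 h2).2
    · rw [hhigh k (by omega)] at h2
      rw [hhigh (k + 1) (by omega)] at h1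
      omega
  · intro k hk
    rw [hhigh k hk, hhigh N le_rfl]
  · rw [hhigh N le_rfl]
    exact hi

lemma IsPattern.exists_copath {N : ℕ} {lam mu : ℕ → ℕ} {g : ℕ → ℕ → ℕ}
    (hg : IsPattern N lam mu g) (hmu : ∀ k, N ≤ k → mu k = 0) {K t : ℕ} (hK : K < N)
    (ht : t ≤ N) (hKt : t < N ∧ K = 0 ∨ t = N ∧ g K (N - 1) = 0) :
    ∃ r, IsCopath N g r ∧ (∀ k, k ≤ K → r k = t) ∧ ∀ k, K < k → r k < N := by
  let Q : ℕ → ℕ → Prop := fun k s => s = 0 ∨ g (k + 1) s < g k (s - 1)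
  let R : ℕ → ℕ := fun d => Nat.rec t (fun d j => Nat.findGreatest (Q (K + d)) j) d
  have hR : ∀ d, R (d + 1) = Nat.findGreatest (Q (K + d)) (R d) := fun d => rfl
  have hanti : ∀ d, R (d + 1) ≤ R d := fun d => by rw [hR]; exact Nat.findGreatest_le _
  have hQ : ∀ d, Q (K + d) (R (d + 1)) := fun d => by
    rw [hR]; exact Nat.findGreatest_spec (P := Q (K + d)) (Nat.zero_le _) (Or.inl rfl)
  have hRN : ∀ d, R d ≤ N := fun d => by
    induction d with
    | zero => exact ht
    | succ d ih => exact (hanti d).trans ih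
  have hlow : ∀ k, k ≤ K → R (k - K) = t := fun k hk => by rw [Nat.sub_eq_zero_of_le hk]; rfl
  have hhigh : ∀ k, K ≤ k → R (k + 1 - K) = Nat.findGreatest (Q k) (R (k - K)) := by
    intro k hk
    have e : k + 1 - K = k - K + 1 := by omega
    have e' : K + (k - K) = k := by omega
    rw [e, hR, e']
  have hQ' : ∀ k, K ≤ k → Q k (R (k + 1 - K)) := by
    intro k hk
    have := hQ (k - K)
    have e : k + 1 - K = k - K + 1 := by omega
    have e' : K + (k - K) = k := by omega
    rwa [e', ← e] at this
  have h1 : R 1 < N := by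
    rcases hKt with h | h
    · exact (hanti 0).trans_lt h.1
    · refine lt_of_le_of_ne (hRN 1) fun e => ?_
      have := hQ 0
      rw [zero_add, e] at this
      rcases this with h' | h'
      · omega
      · rw [add_zero, h.2] at h'; omega
  have hlt : ∀ d, R (d + 1) < N := fun d => by
    induction d with
    | zero => exact h1
    | succ d ih => exact (hanti _).trans_lt ih
  have hltk : ∀ k, K < k → R (k - K) < N := fun k hk => by
    have := hlt (k - K - 1)
    rwa [show k - K - 1 + 1 = k - K by omega] at this
  refine ⟨fun k => R (k - K), ⟨?_, fun k => hRN _, ?_, ?_, ?_, hltk N hK⟩, hlow, hltk⟩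
  · intro k
    by_cases hk : K ≤ k
    · have := hanti (k - K)
      rwa [show k - K + 1 = k + 1 - K by omega] at this
    · rw [hlow k (by omega), hlow (k + 1) (by omega)]
  · intro k h h'
    by_cases hk : K ≤ k
    · have := hQ' k hk
      rcases this with h2 | h2
      · omega
      · exact h2
    · rw [hlow (k + 1) (by omega)] at h
      omega
  · intro k s h h'
    by_cases hk : K ≤ k
    · rw [hhigh k hk] at h
      have h3 := Nat.findGreatest_is_greatest (P := Q k) (n := R (k - K)) (k := s + 1) (by omega)
        (by omega)
      have := hg.strip k s
      simp only [Q, Nat.add_sub_cancel] at h3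
      omega
    · rw [hlow k (by omega)] at h'
      rw [hlow (k + 1) (by omega)] at h
      omega
  · intro k hk
    induction k, hk using Nat.le_induction with
    | base => rfl
    | succ k hk ih =>
      refine Eq.trans ?_ ih
      rw [hhigh k (by omega)]
      have h2 := hQ' (k - 1) (by omega)
      rw [Nat.sub_add_cancel (by omega)] at h2
      refine le_antisymm (Nat.findGreatest_le _) (Nat.le_findGreatest le_rfl ?_)
      rcases h2 with h2 | h2
      · exact Or.inl h2
      · right
        rw [Nat.sub_add_cancel (by omega)] at h2
        rw [hg.succ_eq (hmu k hk)]
        have := hg.le (k - 1) (R (k - K) - 1)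
        rw [Nat.sub_add_cancel (by omega)] at this
        exact h2.trans_le this

/-- The pairs of a pattern and a removal path of it. -/
def pathSet (N : ℕ) (lam mu : ℕ → ℕ) : Set ((ℕ → ℕ → ℕ) × (ℕ → ℕ)) :=
  {x | IsPattern N lam mu x.1 ∧ IsPath N x.1 x.2}

/-- The pattern obtained by removing boxes along a path. -/
def removeBoxes (N : ℕ) (x : (ℕ → ℕ → ℕ) × (ℕ → ℕ)) : ℕ → ℕ → ℕ :=
  fun k s => x.1 k s - if s = x.2 k ∧ x.2 k < N then 1 else 0

/-- The shape with one box fewer in row `t`. -/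
def dec (p : ℕ → ℕ) (t : ℕ) : ℕ → ℕ := fun s => p s - if s = t then 1 else 0

lemma addsBoxes_removeBoxes {N : ℕ} {x : (ℕ → ℕ → ℕ) × (ℕ → ℕ)} (hr : IsPath N x.1 x.2) :
    AddsBoxes N x.1 (removeBoxes N x) x.2 := by
  intro k s
  unfold removeBoxes
  split_ifs with h
  · have := hr.corner k h.2
    rw [h.1]; omega
  · simp

lemma AddsBoxes.eq_removeBoxes {N : ℕ} {g g' : ℕ → ℕ → ℕ} {r : ℕ → ℕ} (h : AddsBoxes N g g' r) :
    removeBoxes N (g, r) = g' := by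
  funext k s
  have := h k s
  simp only [removeBoxes, this, Nat.add_sub_cancel]

lemma AddsBoxes.left_unique {N : ℕ} {g₁ g₂ g' : ℕ → ℕ → ℕ} {r : ℕ → ℕ}
    (h₁ : AddsBoxes N g₁ g' r) (h₂ : AddsBoxes N g₂ g' r) : g₁ = g₂ := by
  funext k s
  rw [h₁ k s, h₂ k s]

lemma IsPath.antitone {N : ℕ} {g : ℕ → ℕ → ℕ} {r : ℕ → ℕ} (hr : IsPath N g r) : Antitone r :=
  antitone_nat_of_succ_le hr.anti

lemma IsPattern.corner_zero {N : ℕ} {lam mu : ℕ → ℕ} {g : ℕ → ℕ → ℕ} {r : ℕ → ℕ}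
    (hg : IsPattern N lam mu g) (hr : IsPath N g r) (h : r 0 < N) :
    lam (r 0 + 1) < lam (r 0) := by
  have h1 := hr.corner 0 h
  have h2 := hg.le 0 (r 0 + 1)
  rw [hg.zero] at h1 h2
  exact h2.trans_lt h1

lemma IsPattern.remove_row {N t : ℕ} {lam mu : ℕ → ℕ} {x : (ℕ → ℕ → ℕ) × (ℕ → ℕ)}
    (hg : IsPattern N lam mu x.1) (hr : IsPath N x.1 x.2) (ht : t < N) (h : x.2 0 = t) :
    IsPattern N (dec lam t) mu (removeBoxes N x) ∧ IsCopath N (removeBoxes N x) x.2 := by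
  refine hg.remove hr (addsBoxes_removeBoxes hr) ?_ ?_
  · funext s
    simp only [removeBoxes, dec, hg.zero, h, ht, and_true]
  · intro k
    have h1 := hr.antitone (Nat.zero_le k)
    have h2 := hr.antitone (Nat.zero_le (k + 1))
    rw [if_pos (by omega), if_pos (by omega)]

lemma IsPattern.pos_of_exit {N K : ℕ} {lam mu : ℕ → ℕ} {g : ℕ → ℕ → ℕ} {r : ℕ → ℕ}
    (hg : IsPattern N lam mu g) (hr : IsPath N g r) (h : r K = N) (h' : r (K + 1) < N) :
    0 < mu K := by
  by_contra h0
  have e := hg.succ_eq (k := K) (by omega)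
  have h1 := hr.chain K (r (K + 1)) le_rfl (by omega)
  have h2 := hr.corner (K + 1) h'
  have h3 := hg.le (K + 1) (r (K + 1) + 1)
  rw [← e] at h1
  omega

lemma IsPattern.remove_letter {N K : ℕ} {lam mu : ℕ → ℕ} {x : (ℕ → ℕ → ℕ) × (ℕ → ℕ)}
    (hg : IsPattern N lam mu x.1) (hr : IsPath N x.1 x.2) (h : ∀ k, x.2 k = N ↔ k ≤ K) :
    IsPattern N lam (dec mu K) (removeBoxes N x) ∧ IsCopath N (removeBoxes N x) x.2 := by
  have hlt : ∀ k, x.2 k < N ↔ ¬ k ≤ K := fun k => by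
    have := hr.le k
    have := h k
    omega
  refine hg.remove hr (addsBoxes_removeBoxes hr) ?_ ?_
  · funext s
    have := (h 0).2 (Nat.zero_le _)
    simp only [removeBoxes, hg.zero, this, lt_irrefl, and_false, if_false, Nat.sub_zero]
  · intro k
    have := hg.pos_of_exit hr ((h K).2 le_rfl) ((hlt (K + 1)).2 (by omega))
    simp only [hlt, dec]
    by_cases hk : k = K
    · subst hk
      simp
      omega
    · rw [if_neg hk]
      split_ifs <;> omega

lemma IsPattern.content_anti {N : ℕ} {lam mu : ℕ → ℕ} {g : ℕ → ℕ → ℕ}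
    (hg : IsPattern N lam mu g) (k : ℕ) : mu (k + 1) ≤ mu k := by
  have h1 := hg.lattice k N
  rw [hg.rowSum_eq _ (N + 1) (by omega), hg.rowSum_eq _ (N + 1) (by omega)] at h1
  have h2 := hg.content k
  have h3 := hg.content (k + 1)
  simp only [add_assoc, Nat.reduceAdd] at *
  omega

lemma IsPattern.corner_letter {N K : ℕ} {lam mu : ℕ → ℕ} {x : (ℕ → ℕ → ℕ) × (ℕ → ℕ)}
    (hg : IsPattern N lam mu x.1) (hr : IsPath N x.1 x.2) (h : ∀ k, x.2 k = N ↔ k ≤ K) :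
    mu (K + 1) < mu K := by
  have h1 := (hg.remove_letter hr h).1.content_anti K
  have h2 := hr.le (K + 1)
  have h3 := h (K + 1)
  have h4 := hg.pos_of_exit hr ((h K).2 le_rfl) (by omega)
  simp only [dec, if_true, Nat.succ_ne_self, if_false] at h1
  omega

lemma bijOn_row {N t : ℕ} {lam mu : ℕ → ℕ} (hmu : ∀ k, N ≤ k → mu k = 0) (ht : t < N)
    (hlam : ∀ s, lam (s + 1) ≤ lam s) (hc : lam (t + 1) < lam t) :
    Set.BijOn (removeBoxes N) {x ∈ pathSet N lam mu | x.2 0 = t}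
      {g | IsPattern N (dec lam t) mu g} := by
  refine ⟨?_, ?_, ?_⟩
  · rintro x ⟨⟨hg, hr⟩, hx⟩
    exact (hg.remove_row hr ht hx).1
  · rintro ⟨g, r⟩ ⟨⟨hg, hr⟩, hx⟩ ⟨g₂, r₂⟩ ⟨⟨hg₂, hr₂⟩, hx₂⟩ h
    have c := (hg.remove_row hr ht hx).2
    have c₂ := (hg₂.remove_row hr₂ ht hx₂).2
    rw [← h] at c₂
    simp only at hx hx₂ c c₂
    obtain rfl : r = r₂ := c.unique c₂ (hx.trans hx₂.symm) fun k => by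
      have h1 := hr.antitone (Nat.zero_le k)
      have h2 := hr₂.antitone (Nat.zero_le k)
      simp only at h1 h2
      omega
    have a := addsBoxes_removeBoxes hr
    have a₂ := addsBoxes_removeBoxes hr₂
    rw [← h] at a₂
    exact Prod.ext (a.left_unique a₂) rfl
  · intro g' hg'
    obtain ⟨r, hr, h0, h1⟩ := IsPattern.exists_copath hg' hmu (K := 0) (t := t) (by omega) ht.le
      (Or.inl ⟨ht, rfl⟩)
    have h0 := h0 0 le_rfl
    have hlt : ∀ k, r k < N := fun k => by
      rcases Nat.eq_zero_or_pos k with rfl | hk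
      · omega
      · exact h1 k hk
    set g : ℕ → ℕ → ℕ := fun k s => g' k s + if s = r k ∧ r k < N then 1 else 0 with hgdef
    have ha : AddsBoxes N g g' r := fun k s => rfl
    have hpq : IsPattern N lam mu g ∧ IsPath N g r := by
      refine IsPattern.insert (lam := lam) (mu := mu) hg' hr ha ?_ ?_ ?_ ?_
      · funext s
        simp only [hgdef, hg'.zero, dec, h0, ht, and_true]
        split_ifs with h
        · subst h; omega
        · rfl
      · intro k
        rw [if_pos (hlt k), if_pos (hlt (k + 1))]
      · intro _ h
        have := hlam (t - 1)
        simp only [h0, dec, if_true] at h ⊢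
        rw [if_neg (by omega)]
        rw [Nat.sub_add_cancel h] at this
        omega
      · intro k h
        have := hlt (k + 1)
        omega
    obtain ⟨p, q⟩ := hpq
    exact ⟨(g, r), ⟨⟨p, q⟩, h0⟩, ha.eq_removeBoxes⟩

lemma IsPattern.rowSum_le {N : ℕ} {lam mu : ℕ → ℕ} {g : ℕ → ℕ → ℕ}
    (hg : IsPattern N lam mu g) (k : ℕ) :
    rowSum (g k) N = rowSum lam N + rowSum mu k := by
  induction k with
  | zero => rw [hg.zero]; simp [rowSum]
  | succ k ih => rw [hg.content, ih, rowSum_succ, add_assoc]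

lemma rowSum_mono (p : ℕ → ℕ) : Monotone (rowSum p) :=
  monotone_nat_of_le_succ fun i => by rw [rowSum_succ]; exact Nat.le_add_right _ _

lemma mul_le_rowSum {p : ℕ → ℕ} (hp : ∀ s, p (s + 1) ≤ p s) (i : ℕ) :
    (i + 1) * p i ≤ rowSum p (i + 1) := by
  induction i with
  | zero => simp [rowSum]
  | succ i ih =>
    rw [rowSum_succ]
    have := Nat.mul_le_mul_left (i + 1) (hp i)
    nlinarith

lemma rowSum_dec {p : ℕ → ℕ} {t N : ℕ} (ht : t < N) (hp : 0 < p t) :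
    rowSum (dec p t) N + 1 = rowSum p N := by
  have : ∀ i, rowSum (dec p t) i + (if t < i then 1 else 0) = rowSum p i := by
    intro i
    induction i with
    | zero => simp [rowSum]
    | succ i ih =>
      rw [rowSum_succ, rowSum_succ, ← ih]
      simp only [dec]
      by_cases h : i = t
      · subst h
        simp
        omega
      · split_ifs <;> omega
  have := this N
  rwa [if_pos ht] at this

lemma bijOn_letter {N K : ℕ} {lam mu : ℕ → ℕ} (hmu : ∀ k, N ≤ k → mu k = 0) (hK : K < N)
    (hmu' : ∀ k, mu (k + 1) ≤ mu k) (hc : mu (K + 1) < mu K)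
    (hN : rowSum lam N + rowSum mu N ≤ N) :
    Set.BijOn (removeBoxes N) {x ∈ pathSet N lam mu | ∀ k, x.2 k = N ↔ k ≤ K}
      {g | IsPattern N lam (dec mu K) g} := by
  refine ⟨?_, ?_, ?_⟩
  · rintro x ⟨⟨hg, hr⟩, hx⟩
    exact (hg.remove_letter hr hx).1
  · rintro ⟨g, r⟩ ⟨⟨hg, hr⟩, hx⟩ ⟨g₂, r₂⟩ ⟨⟨hg₂, hr₂⟩, hx₂⟩ h
    have c := (hg.remove_letter hr hx).2
    have c₂ := (hg₂.remove_letter hr₂ hx₂).2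
    rw [← h] at c₂
    simp only at hx hx₂ c c₂
    obtain rfl : r = r₂ := c.unique c₂
      (((hx 0).2 (Nat.zero_le _)).trans ((hx₂ 0).2 (Nat.zero_le _)).symm) fun k => by
        have h1 := hr.le k
        have h2 := hr₂.le k
        have h3 := hx k
        have h4 := hx₂ k
        simp only at h1 h2
        omega
    have a := addsBoxes_removeBoxes hr
    have a₂ := addsBoxes_removeBoxes hr₂
    rw [← h] at a₂
    exact Prod.ext (a.left_unique a₂) rfl
  · intro g' hg'
    have hg' : IsPattern N lam (dec mu K) g' := hg'
    have hdec := rowSum_dec hK (show 0 < mu K by omega)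
    have hz : g' K (N - 1) = 0 := by
      have h1 := mul_le_rowSum (hg'.anti K) (N - 1)
      rw [Nat.sub_add_cancel (by omega), hg'.rowSum_le] at h1
      have h2 := rowSum_mono (dec mu K) hK.le
      have h3 : N * g' K (N - 1) < N * 1 := by omega
      have := Nat.lt_of_mul_lt_mul_left h3
      omega
    obtain ⟨r, hr, h0, h1⟩ := IsPattern.exists_copath hg'
      (fun k hk => by simp [dec, hmu k hk]) hK (t := N) le_rfl (Or.inr ⟨rfl, hz⟩)
    set g : ℕ → ℕ → ℕ := fun k s => g' k s + if s = r k ∧ r k < N then 1 else 0 with hgdef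
    have ha : AddsBoxes N g g' r := fun k s => rfl
    have hlt : ∀ k, r k < N ↔ K < k := fun k =>
      ⟨fun h => by by_contra h'; have := h0 k (by omega); omega, h1 k⟩
    have hpq : IsPattern N lam mu g ∧ IsPath N g r := by
      refine IsPattern.insert (lam := lam) (mu := mu) hg' hr ha ?_ ?_ ?_ ?_
      · funext s
        simp [hgdef, hg'.zero, hlt]
      · intro k
        simp only [hlt, dec]
        by_cases hk : k = K
        · subst hk
          simp
          omega
        · rw [if_neg hk]
          split_ifs <;> omega
      · intro h
        have := h0 0 (Nat.zero_le _)
        omega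
      · intro k h h'
        have := (hlt (k + 2)).1 h'
        have := (hlt (k + 1)).not.1 (by omega)
        have := hmu' k
        obtain rfl : K = k + 1 := by omega
        simp only [dec, if_true]
        rw [if_neg (by omega)]
        omega
    obtain ⟨p, q⟩ := hpq
    refine ⟨(g, r), ⟨⟨p, q⟩, fun k => ?_⟩, ha.eq_removeBoxes⟩
    have := hlt k
    have := hr.le k
    simp only
    omega

lemma finite_isPattern {N : ℕ} {lam mu : ℕ → ℕ} (hmu : ∀ k, N ≤ k → mu k = 0) :
    {g | IsPattern N lam mu g}.Finite := by
  refine Set.Finite.of_injOn (f := fun g (k : Fin (N + 1)) (s : Fin N) => g k s)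
    (t := Set.Icc 0 (fun _ _ => rowSum lam N + rowSum mu N)) ?_ ?_ (Set.finite_Icc _ _)
  · intro g hg
    refine ⟨fun _ _ => Nat.zero_le _, fun k s => ?_⟩
    have hg : IsPattern N lam mu g := hg
    calc g k s ≤ rowSum (g k) N :=
          Finset.single_le_sum (f := g k) (fun _ _ => Nat.zero_le _) (Finset.mem_range.2 s.2)
      _ = rowSum lam N + rowSum mu k := hg.rowSum_le k
      _ ≤ _ := Nat.add_le_add_left (rowSum_mono mu (Nat.lt_succ_iff.1 k.2)) _
  · intro g hg g' hg' h
    have hg : IsPattern N lam mu g := hg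
    have hg' : IsPattern N lam mu g' := hg'
    have key : ∀ k, k ≤ N → g k = g' k := by
      intro k hk
      funext s
      by_cases hs : s < N
      · exact congrFun (congrFun h ⟨k, Nat.lt_succ_of_le hk⟩) ⟨s, hs⟩
      · rw [hg.supp _ _ (by omega), hg'.supp _ _ (by omega)]
    funext k
    rcases le_total k N with hk | hk
    · exact key k hk
    · rw [hg.const hmu k hk, hg'.const hmu k hk, key N le_rfl]

lemma finite_pathSet {N : ℕ} {lam mu : ℕ → ℕ} (hmu : ∀ k, N ≤ k → mu k = 0) :
    (pathSet N lam mu).Finite := by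
  refine Set.Finite.of_injOn (f := fun x => (x.1, x.2 N))
    (t := {g | IsPattern N lam mu g} ×ˢ Set.Iio N) ?_ ?_
    ((finite_isPattern hmu).prod (Set.finite_Iio N))
  · rintro x ⟨hg, hr⟩
    exact ⟨hg, hr.lt⟩
  · rintro ⟨g, r⟩ ⟨hg, hr⟩ ⟨g₂, r₂⟩ ⟨hg₂, hr₂⟩ h
    obtain ⟨h1, h2⟩ := Prod.mk.injEq _ _ _ _ ▸ h
    obtain rfl : g = g₂ := h1
    exact Prod.ext rfl (hr.unique hr₂ h2)

/-- The Jacobi–Trudi determinant of the first `N` parts of `p`. -/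
def rowDet (N : ℕ) (p : ℕ → ℕ) : ℚ := jacobiTrudi (fun s : Fin N => (p s : ℤ))

lemma rowSum_mul_rowDet {N : ℕ} {p : ℕ → ℕ} (hp : ∀ s, p (s + 1) ≤ p s)
    (hN : ∀ s, N ≤ s → p s = 0) :
    (rowSum p N : ℚ) * rowDet N p =
      ∑ i ∈ Finset.range N, if p (i + 1) < p i then rowDet N (dec p i) else 0 := by
  have h := sum_mul_jacobiTrudi (fun s : Fin N => (p s : ℤ))
  have e : ((∑ i : Fin N, (p i : ℤ) : ℤ) : ℚ) = rowSum p N := by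
    rw [Fin.sum_univ_eq_sum_range (fun i => (p i : ℤ)), rowSum]
    push_cast
    rfl
  rw [e] at h
  rw [rowDet, h, Finset.sum_range]
  refine Finset.sum_congr rfl fun i _ => ?_
  split_ifs with hi
  · unfold rowDet
    congr 1
    funext s
    simp only [dec, Fin.ext_iff]
    split_ifs with hs
    · have := hs ▸ hi
      push_cast [show 1 ≤ p s by omega]
      rfl
    · simp
  · exact jacobiTrudi_sub_eq_zero p i hN (le_antisymm (not_lt.1 hi) (hp i))

/-- The sum of `rowDet` over the final shapes of all patterns. -/
def patternSum (N : ℕ) (lam mu : ℕ → ℕ) : ℚ :=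
  ∑ᶠ g ∈ {g | IsPattern N lam mu g}, rowDet N (g N)

lemma rowSum_mul_patternSum {N : ℕ} {lam mu : ℕ → ℕ} (hmu : ∀ k, N ≤ k → mu k = 0) :
    ((rowSum lam N + rowSum mu N : ℕ) : ℚ) * patternSum N lam mu =
      ∑ x ∈ (finite_pathSet (lam := lam) hmu).toFinset, rowDet N (removeBoxes N x N) := by
  rw [patternSum, finsum_mem_eq_finite_toFinset_sum _ (finite_isPattern hmu), Finset.mul_sum]
  calc _ = ∑ g ∈ (finite_isPattern (lam := lam) hmu).toFinset, ∑ i ∈ Finset.range N,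
        if g N (i + 1) < g N i then rowDet N (dec (g N) i) else 0 := by
        refine Finset.sum_congr rfl fun g hg => ?_
        have hg : IsPattern N lam mu g := (Set.Finite.mem_toFinset _).1 hg
        rw [← hg.rowSum_le N, rowSum_mul_rowDet (hg.anti N) (hg.supp N)]
    _ = ∑ y ∈ ((finite_isPattern (lam := lam) hmu).toFinset ×ˢ Finset.range N) with
        y.1 N (y.2 + 1) < y.1 N y.2, rowDet N (dec (y.1 N) y.2) := by
        rw [Finset.sum_filter, Finset.sum_product]
    _ = _ := by
        symm
        refine Finset.sum_bij (fun x _ => (x.1, x.2 N)) ?_ ?_ ?_ ?_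
        · intro x hx
          obtain ⟨hg, hr⟩ := (Set.Finite.mem_toFinset _).1 hx
          simp only [Finset.mem_filter, Finset.mem_product, Set.Finite.mem_toFinset,
            Finset.mem_range]
          refine ⟨⟨hg, hr.lt⟩, ?_⟩
          have := hr.corner N hr.lt
          rwa [hg.const hmu (N + 1) (Nat.le_succ N)] at this
        · rintro ⟨g, r⟩ hx ⟨g₂, r₂⟩ hx₂ h
          obtain ⟨hg, hr⟩ := (Set.Finite.mem_toFinset _).1 hx
          obtain ⟨hg₂, hr₂⟩ := (Set.Finite.mem_toFinset _).1 hx₂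
          obtain ⟨h1, h2⟩ := Prod.mk.injEq _ _ _ _ ▸ h
          obtain rfl : g = g₂ := h1
          exact Prod.ext rfl (hr.unique hr₂ h2)
        · rintro ⟨g, i⟩ hy
          simp only [Finset.mem_filter, Finset.mem_product, Set.Finite.mem_toFinset,
            Finset.mem_range] at hy
          have hg : IsPattern N lam mu g := hy.1.1
          obtain ⟨r, hr, rfl⟩ := hg.exists_path hmu hy.1.2 hy.2
          exact ⟨(g, r), (Set.Finite.mem_toFinset _).2 ⟨hg, hr⟩, rfl⟩
        · intro x hx
          obtain ⟨hg, hr⟩ := (Set.Finite.mem_toFinset _).1 hx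
          congr 1
          funext s
          simp [removeBoxes, dec, hr.lt]

/-- The label of a removal path: the row where it ends, or `N` plus the letter which is lost. -/
def pathLabel (N : ℕ) (r : ℕ → ℕ) : ℕ :=
  if r 0 < N then r 0 else N + Nat.findGreatest (fun k => r k = N) N

lemma pathLabel_eq_row {N t : ℕ} {r : ℕ → ℕ} (ht : t < N) : pathLabel N r = t ↔ r 0 = t := by
  unfold pathLabel
  split_ifs <;> omega

lemma IsPath.pathLabel_eq_letter {N K : ℕ} {g : ℕ → ℕ → ℕ} {r : ℕ → ℕ} (hr : IsPath N g r) :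
    pathLabel N r = N + K ↔ ∀ k, r k = N ↔ k ≤ K := by
  have h0 := hr.le 0
  constructor
  · intro h
    unfold pathLabel at h
    split_ifs at h with h1
    · omega
    · have hK : Nat.findGreatest (fun k => r k = N) N = K := by omega
      have hspec : r K = N := by
        rw [← hK]
        exact Nat.findGreatest_spec (P := fun k => r k = N) (Nat.zero_le N) (by omega)
      intro k
      constructor
      · intro hk
        rcases le_total k N with hkN | hkN
        · rw [← hK]
          exact Nat.le_findGreatest hkN hk
        · have := hr.antitone hkN
          have := hr.lt
          omega
      · intro hk
        have := hr.antitone hk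
        have := hr.le k
        omega
  · intro h
    have h1 := (h 0).2 (Nat.zero_le _)
    have h2 := hr.lt
    have hKN : K ≤ N := by
      by_contra hlt
      have := (h N).2 (by omega)
      omega
    rw [pathLabel, if_neg (by omega)]
    congr 1
    refine le_antisymm ?_ (Nat.le_findGreatest hKN ((h K).2 le_rfl))
    exact (h _).1 (Nat.findGreatest_spec (P := fun k => r k = N) (Nat.zero_le N) h1)

lemma IsPath.pathLabel_lt {N : ℕ} {g : ℕ → ℕ → ℕ} {r : ℕ → ℕ} (hr : IsPath N g r) :
    pathLabel N r < N + N := by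
  obtain ⟨K, hK⟩ | h : (∃ K, pathLabel N r = N + K) ∨ pathLabel N r < N := by
    rcases lt_or_ge (pathLabel N r) N with h | h
    · exact Or.inr h
    · exact Or.inl (Nat.exists_eq_add_of_le h)
  · have h2 := hr.lt
    have := (hr.pathLabel_eq_letter.1 hK N).not.1 (by omega)
    omega
  · omega

lemma sum_pathSet {N : ℕ} {lam mu : ℕ → ℕ} (hlam : ∀ s, lam (s + 1) ≤ lam s)
    (hmu' : ∀ s, mu (s + 1) ≤ mu s) (hmu : ∀ k, N ≤ k → mu k = 0)
    (hN : rowSum lam N + rowSum mu N ≤ N) :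
    ∑ x ∈ (finite_pathSet (lam := lam) hmu).toFinset, rowDet N (removeBoxes N x N) =
      (∑ t ∈ Finset.range N, if lam (t + 1) < lam t then patternSum N (dec lam t) mu else 0) +
      ∑ t ∈ Finset.range N, if mu (t + 1) < mu t then patternSum N lam (dec mu t) else 0 := by
  rw [← Finset.sum_fiberwise_of_maps_to (t := Finset.range (N + N))
    (g := fun x => pathLabel N x.2), Finset.sum_range_add]
  · congr 1
    · refine Finset.sum_congr rfl fun t ht => ?_
      have ht := Finset.mem_range.1 ht
      rw [← finsum_mem_coe_finset]
      have e : (((finite_pathSet (lam := lam) hmu).toFinset.filter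
          (fun x => pathLabel N x.2 = t) : Finset _) : Set _) =
          {x ∈ pathSet N lam mu | x.2 0 = t} := by
        ext x
        simp [pathLabel_eq_row ht]
      rw [e]
      split_ifs with hc
      · exact finsum_mem_eq_of_bijOn _ (bijOn_row hmu ht hlam hc) fun _ _ => rfl
      · rw [show {x ∈ pathSet N lam mu | x.2 0 = t} = ∅ from ?_, finsum_mem_empty]
        refine Set.eq_empty_of_forall_notMem ?_
        rintro x ⟨⟨hg, hr⟩, rfl⟩
        exact hc (hg.corner_zero hr ht)
    · refine Finset.sum_congr rfl fun K hK => ?_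
      have hK := Finset.mem_range.1 hK
      rw [← finsum_mem_coe_finset]
      have e : (((finite_pathSet (lam := lam) hmu).toFinset.filter
          (fun x => pathLabel N x.2 = N + K) : Finset _) : Set _) =
          {x ∈ pathSet N lam mu | ∀ k, x.2 k = N ↔ k ≤ K} := by
        ext x
        simp only [Finset.coe_filter, Set.Finite.mem_toFinset]
        exact and_congr_right fun hx => hx.2.pathLabel_eq_letter
      rw [e]
      split_ifs with hc
      · exact finsum_mem_eq_of_bijOn _ (bijOn_letter hmu hK hmu' hc hN) fun _ _ => rfl
      · rw [show {x ∈ pathSet N lam mu | ∀ k, x.2 k = N ↔ k ≤ K} = ∅ from ?_, finsum_mem_empty]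
        refine Set.eq_empty_of_forall_notMem ?_
        rintro x ⟨⟨hg, hr⟩, hx⟩
        exact hc (hg.corner_letter hr hx)
  · intro x hx
    exact Finset.mem_range.2 (((Set.Finite.mem_toFinset _).1 hx).2.pathLabel_lt)

lemma dec_anti {p : ℕ → ℕ} {t : ℕ} (hp : ∀ s, p (s + 1) ≤ p s) (hc : p (t + 1) < p t) (s : ℕ) :
    dec p t (s + 1) ≤ dec p t s := by
  have := hp s
  simp only [dec]
  split_ifs with h1 h2 h2
  · omega
  · omega
  · subst h2; omega
  · omega

lemma dec_supp {p : ℕ → ℕ} {t N : ℕ} (hp : ∀ s, N ≤ s → p s = 0) (s : ℕ) (hs : N ≤ s) :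
    dec p t s = 0 := by
  simp [dec, hp s hs]

lemma rowDet_zero (N : ℕ) : rowDet N 0 = 1 := by
  have h := jacobiTrudi_rowLen (⊥ : YoungDiagram) (N := N)
    (by simp [YoungDiagram.colLen_eq_card, YoungDiagram.col])
  have h0 : ∀ s, (⊥ : YoungDiagram).rowLen s = 0 := fun s => by
    simp [YoungDiagram.rowLen_eq_card, YoungDiagram.row]
  simp only [h0, hookProd, YoungDiagram.cells_bot, Finset.prod_empty, div_one] at h
  exact h

lemma rowSum_eq_zero {p : ℕ → ℕ} {N : ℕ} (hp : ∀ s, N ≤ s → p s = 0) (h : rowSum p N = 0) :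
    p = 0 := by
  funext s
  by_cases hs : s < N
  · exact Finset.sum_eq_zero_iff.1 h s (Finset.mem_range.2 hs)
  · exact hp s (by omega)

theorem patternSum_eq {N : ℕ} : ∀ {lam mu : ℕ → ℕ}, (∀ s, lam (s + 1) ≤ lam s) →
    (∀ s, mu (s + 1) ≤ mu s) → (∀ k, N ≤ k → lam k = 0) → (∀ k, N ≤ k → mu k = 0) →
    rowSum lam N + rowSum mu N ≤ N → patternSum N lam mu = rowDet N lam * rowDet N mu := by
  suffices H : ∀ n, ∀ {lam mu : ℕ → ℕ}, (∀ s, lam (s + 1) ≤ lam s) →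
      (∀ s, mu (s + 1) ≤ mu s) → (∀ k, N ≤ k → lam k = 0) → (∀ k, N ≤ k → mu k = 0) →
      rowSum lam N + rowSum mu N = n → n ≤ N →
      patternSum N lam mu = rowDet N lam * rowDet N mu from
    fun {_ _} h1 h2 h3 h4 h5 => H _ h1 h2 h3 h4 rfl h5
  intro n
  induction n with
  | zero =>
    intro lam mu _ _ hl hm h _
    obtain rfl := rowSum_eq_zero hl (by omega)
    obtain rfl := rowSum_eq_zero hm (by omega)
    have : {g | IsPattern N 0 0 g} = {0} := by
      ext g
      simp only [Set.mem_ofPred_eq, Set.mem_singleton_iff]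
      constructor
      · intro hg
        funext k
        refine rowSum_eq_zero (hg.supp k) ?_
        rw [hg.rowSum_le]
        simp [rowSum]
      · rintro rfl
        constructor <;> simp [rowSum]
    rw [patternSum, this, finsum_mem_singleton, Pi.zero_apply, rowDet_zero, one_mul]
  | succ n ih =>
    intro lam mu hl hm hl0 hm0 h hN
    have key := rowSum_mul_patternSum (lam := lam) hm0
    rw [sum_pathSet hl hm hm0 (by omega)] at key
    have h1 : (∑ t ∈ Finset.range N,
        if lam (t + 1) < lam t then patternSum N (dec lam t) mu else 0) =
        (rowSum lam N * rowDet N lam) * rowDet N mu := by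
      rw [rowSum_mul_rowDet hl hl0, Finset.sum_mul]
      refine Finset.sum_congr rfl fun t ht => ?_
      split_ifs with hc
      · have := rowSum_dec (Finset.mem_range.1 ht) (show 0 < lam t by omega)
        exact ih (dec_anti hl hc) hm (dec_supp hl0) hm0 (by omega) (by omega)
      · rw [zero_mul]
    have h2 : (∑ t ∈ Finset.range N,
        if mu (t + 1) < mu t then patternSum N lam (dec mu t) else 0) =
        (rowSum mu N * rowDet N mu) * rowDet N lam := by
      rw [rowSum_mul_rowDet hm hm0, Finset.sum_mul]
      refine Finset.sum_congr rfl fun t ht => ?_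
      split_ifs with hc
      · have := rowSum_dec (Finset.mem_range.1 ht) (show 0 < mu t by omega)
        rw [ih hl (dec_anti hm hc) hl0 (dec_supp hm0) (by omega) (by omega), mul_comm]
      · rw [zero_mul]
    rw [h1, h2] at key
    have hn : ((rowSum lam N + rowSum mu N : ℕ) : ℚ) ≠ 0 := by
      rw [h]; exact Nat.cast_ne_zero.2 (Nat.succ_ne_zero n)
    refine mul_left_cancel₀ hn ?_
    rw [key]
    push_cast
    ring

/-- The cells of `nu` filled by `T` with values at most `k` form the shape `g k`, for every `k`. -/
structure EncodesTableau (nu : YoungDiagram) (T : ℕ × ℕ → ℕ) (g : ℕ → ℕ → ℕ) : Prop where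
  out : ∀ i j, nu.rowLen i ≤ j → T (i, j) = 0
  lt_iff : ∀ i j k, j < g k i ↔ j < nu.rowLen i ∧ T (i, j) ≤ k

lemma mem_skew_iff {lam nu : YoungDiagram} {i j : ℕ} :
    (i, j) ∈ nu.cells \ lam.cells ↔ j < nu.rowLen i ∧ lam.rowLen i ≤ j := by
  rw [Finset.mem_sdiff, YoungDiagram.mem_cells, YoungDiagram.mem_cells,
    YoungDiagram.mem_iff_lt_rowLen, YoungDiagram.mem_iff_lt_rowLen, not_lt]

lemma rowLen_injective : Function.Injective YoungDiagram.rowLen := by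
  intro ν κ h
  refine YoungDiagram.ext ?_
  ext ⟨i, j⟩
  rw [YoungDiagram.mem_cells, YoungDiagram.mem_cells, YoungDiagram.mem_iff_lt_rowLen,
    YoungDiagram.mem_iff_lt_rowLen, h]

lemma le_iff_rowLen_le {ν κ : YoungDiagram} : ν ≤ κ ↔ ∀ i, ν.rowLen i ≤ κ.rowLen i := by
  constructor
  · intro h i
    by_contra hlt
    have h1 : (i, κ.rowLen i) ∈ ν := YoungDiagram.mem_iff_lt_rowLen.2 (not_le.1 hlt)
    exact lt_irrefl _ (YoungDiagram.mem_iff_lt_rowLen.1 (YoungDiagram.cells_subset_iff.2 h h1))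
  · rintro h ⟨i, j⟩ hc
    have h1 := YoungDiagram.mem_iff_lt_rowLen.1 hc
    exact YoungDiagram.mem_iff_lt_rowLen.2 (h1.trans_le (h i))

lemma colLen_zero_le_card (ν : YoungDiagram) : ν.colLen 0 ≤ ν.card := by
  rw [YoungDiagram.colLen_eq_card]
  exact Finset.card_filter_le _ _

lemma rowLen_eq_zero {ν : YoungDiagram} {i : ℕ} (h : ν.colLen 0 ≤ i) : ν.rowLen i = 0 := by
  by_contra h0
  have h1 : (i, 0) ∈ ν := YoungDiagram.mem_iff_lt_rowLen.2 (Nat.pos_of_ne_zero h0)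
  have := YoungDiagram.mem_iff_lt_colLen.1 h1
  omega

lemma rowSum_rowLen {ν : YoungDiagram} {N : ℕ} (h : ∀ i, N ≤ i → ν.rowLen i = 0) :
    rowSum ν.rowLen N = ν.card := by
  rw [YoungDiagram.card, Finset.card_eq_sum_card_fiberwise (f := Prod.fst)
    (t := Finset.range N), rowSum]
  · refine Finset.sum_congr rfl fun i _ => ?_
    rw [YoungDiagram.rowLen_eq_card]
    rfl
  · rintro ⟨i, j⟩ hc
    have h1 := YoungDiagram.mem_iff_lt_rowLen.1 hc
    refine Finset.mem_coe.2 (Finset.mem_range.2 ?_)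
    by_contra hlt
    rw [h i (by omega)] at h1
    omega

lemma exists_rowLen_eq {N : ℕ} {p : ℕ → ℕ} (hp : ∀ s, p (s + 1) ≤ p s)
    (hN : ∀ s, N ≤ s → p s = 0) : ∃ ν : YoungDiagram, ν.rowLen = p := by
  have hanti : Antitone p := antitone_nat_of_succ_le hp
  refine ⟨⟨(Finset.range N ×ˢ Finset.range (p 0)).filter (fun c => c.2 < p c.1), ?_⟩, ?_⟩
  · rintro ⟨i, j⟩ ⟨i', j'⟩ hle hc
    have h1 : i' ≤ i := hle.1
    have h2 : j' ≤ j := hle.2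
    simp only [Finset.coe_filter, Finset.mem_product, Finset.mem_range, Set.mem_ofPred_eq] at hc ⊢
    have := hanti h1
    omega
  · funext i
    refine eq_of_forall_lt_iff fun j => ?_
    rw [← YoungDiagram.mem_iff_lt_rowLen, ← YoungDiagram.mem_cells]
    simp only [Finset.mem_filter, Finset.mem_product, Finset.mem_range]
    have := hanti (Nat.zero_le i)
    have := hN i
    omega

lemma EncodesTableau.right_unique {nu : YoungDiagram} {T : ℕ × ℕ → ℕ} {g g' : ℕ → ℕ → ℕ}
    (h : EncodesTableau nu T g) (h' : EncodesTableau nu T g') : g = g' := by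
  funext k i
  exact eq_of_forall_lt_iff fun j => (h.lt_iff i j k).trans (h'.lt_iff i j k).symm

lemma EncodesTableau.left_unique {nu : YoungDiagram} {T T' : ℕ × ℕ → ℕ} {g : ℕ → ℕ → ℕ}
    (h : EncodesTableau nu T g) (h' : EncodesTableau nu T' g) : T = T' := by
  funext ⟨i, j⟩
  by_cases hj : j < nu.rowLen i
  · refine eq_of_forall_ge_iff fun k => ?_
    have h1 := h.lt_iff i j k
    rw [h'.lt_iff i j k] at h1
    simpa [hj, iff_comm] using h1
  · rw [h.out i j (not_lt.1 hj), h'.out i j (not_lt.1 hj)]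

lemma EncodesTableau.eq_succ_iff {nu : YoungDiagram} {T : ℕ × ℕ → ℕ} {g : ℕ → ℕ → ℕ}
    (h : EncodesTableau nu T g) (i j k : ℕ) :
    T (i, j) = k + 1 ↔ g k i ≤ j ∧ j < g (k + 1) i := by
  rw [← not_lt, h.lt_iff, h.lt_iff]
  have := h.out i j
  omega

lemma EncodesTableau.ne_zero_iff {lam nu : YoungDiagram} {T : ℕ × ℕ → ℕ} {g : ℕ → ℕ → ℕ}
    (h : EncodesTableau nu T g) (h0 : g 0 = lam.rowLen) (c : ℕ × ℕ) :
    c ∈ nu.cells \ lam.cells ↔ T c ≠ 0 := by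
  obtain ⟨i, j⟩ := c
  have h1 := h.lt_iff i j 0
  have h2 := h.out i j
  rw [mem_skew_iff, ← h0]
  omega

lemma EncodesTableau.rowSum_succ {lam nu : YoungDiagram} {T : ℕ × ℕ → ℕ} {g : ℕ → ℕ → ℕ}
    (h : EncodesTableau nu T g) (h0 : g 0 = lam.rowLen) (k i : ℕ) :
    rowSum (g (k + 1)) i = rowSum (g k) i +
      ((nu.cells \ lam.cells).filter (fun c => c.1 < i ∧ T c = k + 1)).card := by
  induction i with
  | zero => simp [rowSum]
  | succ i ih =>
    have hle : g k i ≤ g (k + 1) i := by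
      refine le_of_forall_lt fun j hj => ?_
      rw [h.lt_iff] at hj ⊢
      exact ⟨hj.1, hj.2.trans (Nat.le_succ k)⟩
    have e : (nu.cells \ lam.cells).filter (fun c => c.1 < i + 1 ∧ T c = k + 1) =
        (nu.cells \ lam.cells).filter (fun c => c.1 < i ∧ T c = k + 1) ∪
          (Finset.Ico (g k i) (g (k + 1) i)).image (Prod.mk i) := by
      ext ⟨a, b⟩
      simp only [Finset.mem_filter, Finset.mem_union, Finset.mem_image, Finset.mem_Ico,
        Prod.mk.injEq, h.ne_zero_iff h0]
      constructor
      · rintro ⟨h1, h2, h3⟩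
        rcases Nat.lt_succ_iff_lt_or_eq.1 h2 with h2 | rfl
        · exact Or.inl ⟨h1, h2, h3⟩
        · exact Or.inr ⟨b, (h.eq_succ_iff _ _ _).1 h3, rfl, rfl⟩
      · rintro (⟨h1, h2, h3⟩ | ⟨b, h1, rfl, rfl⟩)
        · exact ⟨h1, h2.trans (Nat.lt_succ_self i), h3⟩
        · have := (h.eq_succ_iff _ _ _).2 h1
          exact ⟨by omega, Nat.lt_succ_self _, this⟩
    rw [ChernTensor.rowSum_succ, ChernTensor.rowSum_succ, ih, e, Finset.card_union_of_disjoint,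
      Finset.card_image_of_injective _ (Prod.mk_right_injective i), Nat.card_Ico]
    · omega
    · rw [Finset.disjoint_left]
      rintro ⟨a, b⟩ h1 h2
      simp only [Finset.mem_filter, Finset.mem_image, Prod.mk.injEq] at h1 h2
      obtain ⟨_, _, rfl, _⟩ := h2
      exact lt_irrefl _ h1.2.1

lemma IsLRTableau.exists_encodes {lam mu nu : YoungDiagram} {T : ℕ × ℕ → ℕ}
    (hT : IsLRTableau lam mu nu T) : ∃ g, EncodesTableau nu T g := by
  obtain ⟨hsupp, hrow, -⟩ := hT
  have hex : ∀ k i, ∃ j, ¬ (j < nu.rowLen i ∧ T (i, j) ≤ k) := fun k i =>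
    ⟨nu.rowLen i, fun h => lt_irrefl _ h.1⟩
  refine ⟨fun k i => Nat.find (hex k i), fun i j hj => ?_, fun i j k => ?_⟩
  · by_contra h0
    have := (mem_skew_iff.1 ((hsupp (i, j)).2 h0)).1
    omega
  · rw [Nat.lt_find_iff]
    simp only [not_not]
    refine ⟨fun h => h j le_rfl, fun h m hm => ⟨hm.trans_lt h.1, ?_⟩⟩
    by_cases h0 : T (i, m) = 0
    · omega
    · have h1 := (hsupp (i, m)).2 h0
      refine (hrow i m j hm h1 (mem_skew_iff.2 ⟨h.1, ?_⟩)).trans h.2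
      exact (mem_skew_iff.1 h1).2.trans hm

lemma EncodesTableau.isPattern {lam mu nu : YoungDiagram} {T : ℕ × ℕ → ℕ} {g : ℕ → ℕ → ℕ}
    {N : ℕ} (h : EncodesTableau nu T g) (hT : IsLRTableau lam mu nu T) (hle : lam ≤ nu)
    (hmu : ∀ k, N ≤ k → mu.rowLen k = 0) (hnu : ∀ k, N ≤ k → nu.rowLen k = 0) :
    IsPattern N lam.rowLen mu.rowLen g ∧ g N = nu.rowLen := by
  obtain ⟨hsupp, hrow, hcol, hcont, hlat⟩ := hT
  have hle := le_iff_rowLen_le.1 hle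
  have h0 : g 0 = lam.rowLen := by
    funext i
    refine eq_of_forall_lt_iff fun j => ?_
    rw [h.lt_iff]
    have h1 := hsupp (i, j)
    rw [mem_skew_iff] at h1
    have := hle i
    omega
  have hcount := h.rowSum_succ h0
  refine ⟨⟨h0, ?_, ?_, ?_, ?_, ?_⟩, ?_⟩
  · intro k i
    refine le_of_forall_lt fun j hj => ?_
    rw [h.lt_iff] at hj ⊢
    exact ⟨hj.1, hj.2.trans (Nat.le_succ k)⟩
  · intro k i
    refine le_of_forall_lt fun j hj => ?_
    rw [h.lt_iff] at hj ⊢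
    have h1 : nu.rowLen (i + 1) ≤ nu.rowLen i := nu.rowLen_anti _ _ (Nat.le_succ i)
    have h1' : lam.rowLen (i + 1) ≤ lam.rowLen i := lam.rowLen_anti _ _ (Nat.le_succ i)
    refine ⟨hj.1.trans_le h1, ?_⟩
    by_cases hz : T (i, j) = 0
    · omega
    · have h2 := (hsupp (i, j)).2 hz
      have h3 := hcol i (i + 1) j (Nat.lt_succ_self i) h2
        (mem_skew_iff.2 ⟨hj.1, h1'.trans (mem_skew_iff.1 h2).2⟩)
      omega
  · intro k
    rw [hcount, ← hcont k]
    congr 2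
    refine Finset.filter_congr ?_
    rintro ⟨i, j⟩ hc
    refine and_iff_right ?_
    by_contra hlt
    have := (mem_skew_iff.1 hc).1
    rw [hnu i (not_lt.1 hlt)] at this
    omega
  · intro k i
    rw [hcount (k + 1) (i + 1), hcount k i]
    suffices H : ((nu.cells \ lam.cells).filter (fun c => c.1 < i + 1 ∧ T c = k + 1 + 1)).card ≤
        ((nu.cells \ lam.cells).filter (fun c => c.1 < i ∧ T c = k + 1)).card by omega
    induction i with
    | zero =>
      by_cases hz : g (k + 1) 0 < g (k + 2) 0
      · have hc := (h.eq_succ_iff 0 _ (k + 1)).2 ⟨le_rfl, hz⟩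
        refine le_trans (Finset.card_le_card ?_) ((hlat (0, g (k + 1) 0)
          ((h.ne_zero_iff h0 _).2 (by omega)) k).trans (Finset.card_le_card ?_))
        · rintro ⟨a, b⟩ hd
          simp only [Finset.mem_filter] at hd ⊢
          obtain ⟨h1, h2, h3⟩ := hd
          obtain rfl : a = 0 := by omega
          exact ⟨h1, Or.inr ⟨rfl, ((h.eq_succ_iff _ _ _).1 h3).1⟩, h3⟩
        · rintro ⟨a, b⟩ hd
          simp only [Finset.mem_filter] at hd ⊢
          obtain ⟨h1, h2 | ⟨rfl, h2⟩, h3⟩ := hd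
          · omega
          · have := ((h.eq_succ_iff _ _ _).1 h3).2
            omega
      · rw [Finset.card_eq_zero.2]
        · exact Nat.zero_le _
        · refine Finset.filter_eq_empty_iff.2 ?_
          rintro ⟨a, b⟩ _ ⟨h1, h2⟩
          obtain rfl : a = 0 := by omega
          have := (h.eq_succ_iff _ _ _).1 h2
          exact hz (this.1.trans_lt this.2)
    | succ i ih =>
      by_cases hz : g (k + 1) (i + 1) < g (k + 2) (i + 1)
      · have hc := (h.eq_succ_iff (i + 1) _ (k + 1)).2 ⟨le_rfl, hz⟩
        refine le_trans (Finset.card_le_card ?_) ((hlat (i + 1, g (k + 1) (i + 1))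
          ((h.ne_zero_iff h0 _).2 (by omega)) k).trans (Finset.card_le_card ?_))
        · rintro ⟨a, b⟩ hd
          simp only [Finset.mem_filter] at hd ⊢
          obtain ⟨h1, h2, h3⟩ := hd
          rcases Nat.lt_succ_iff_lt_or_eq.1 h2 with h2 | rfl
          · exact ⟨h1, Or.inl h2, h3⟩
          · exact ⟨h1, Or.inr ⟨rfl, ((h.eq_succ_iff _ _ _).1 h3).1⟩, h3⟩
        · rintro ⟨a, b⟩ hd
          simp only [Finset.mem_filter] at hd ⊢
          obtain ⟨h1, h2 | ⟨rfl, h2⟩, h3⟩ := hd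
          · exact ⟨h1, h2, h3⟩
          · have := ((h.eq_succ_iff _ _ _).1 h3).2
            omega
      · refine le_trans (Finset.card_le_card ?_) (ih.trans (Finset.card_le_card ?_))
        · rintro ⟨a, b⟩ hd
          simp only [Finset.mem_filter] at hd ⊢
          obtain ⟨h1, h2, h3⟩ := hd
          refine ⟨h1, ?_, h3⟩
          by_contra hlt
          obtain rfl : a = i + 1 := by omega
          have := (h.eq_succ_iff _ _ _).1 h3
          exact hz (this.1.trans_lt this.2)
        · refine Finset.monotone_filter_right _ fun c _ hc => ?_
          exact ⟨hc.1.trans (Nat.lt_succ_self i), hc.2⟩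
  · intro k i hi
    by_contra hz
    have := ((h.lt_iff i 0 k).1 (Nat.pos_of_ne_zero hz)).1
    rw [hnu i hi] at this
    omega
  · funext i
    refine eq_of_forall_lt_iff fun j => ?_
    rw [h.lt_iff]
    refine and_iff_left_of_imp fun hj => ?_
    by_contra hlt
    obtain ⟨k, hk⟩ : ∃ k, T (i, j) = k + 1 := Nat.exists_eq_succ_of_ne_zero (by omega)
    have h1 : (i, j) ∈ (nu.cells \ lam.cells).filter (fun c => T c = k + 1) :=
      Finset.mem_filter.2 ⟨(hsupp _).2 (by omega), hk⟩
    have h2 := Finset.card_pos.2 ⟨_, h1⟩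
    rw [hcont, hmu k (by omega)] at h2
    omega

lemma IsPattern.exists_encodes {lam mu : ℕ → ℕ} {nu : YoungDiagram} {N : ℕ} {g : ℕ → ℕ → ℕ}
    (hg : IsPattern N lam mu g) (hmu : ∀ k, N ≤ k → mu k = 0) (hN : g N = nu.rowLen) :
    ∃ T, EncodesTableau nu T g := by
  have hmono : ∀ i, Monotone fun k => g k i := fun i => monotone_nat_of_le_succ fun k => hg.le k i
  have hex : ∀ i j, ∃ k, (j < g k i ∨ nu.rowLen i ≤ j) ∧
      ∀ m, (j < g m i ∨ nu.rowLen i ≤ j) → k ≤ m := fun i j => by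
    have h : ∃ k, j < g k i ∨ nu.rowLen i ≤ j := ⟨N, by rw [hN]; exact lt_or_ge _ _⟩
    exact ⟨Nat.find h, Nat.find_spec h, fun m hm => Nat.find_min' h hm⟩
  choose T hT hmin using hex
  refine ⟨fun c => T c.1 c.2, fun i j hj => ?_, fun i j k => ?_⟩
  · exact Nat.le_zero.1 (hmin i j 0 (Or.inr hj))
  · constructor
    · intro h
      have h1 : j < g N i := by
        rcases le_total k N with hk | hk
        · exact h.trans_le (hmono i hk)
        · rwa [hg.const hmu k hk] at h
      rw [hN] at h1
      exact ⟨h1, hmin i j k (Or.inl h)⟩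
    · rintro ⟨h1, h2⟩
      exact ((hT i j).resolve_right (not_le.2 h1)).trans_le (hmono i h2)

lemma EncodesTableau.isLRTableau {lam mu nu : YoungDiagram} {T : ℕ × ℕ → ℕ} {g : ℕ → ℕ → ℕ}
    {N : ℕ} (h : EncodesTableau nu T g) (hg : IsPattern N lam.rowLen mu.rowLen g)
    (hN : g N = nu.rowLen) : IsLRTableau lam mu nu T := by
  have h0 := hg.zero
  have hcount := h.rowSum_succ h0
  refine ⟨h.ne_zero_iff h0, ?_, ?_, ?_, ?_⟩
  · intro i j j' hj h1 h2
    have h3 := (h.lt_iff i j' (T (i, j'))).2 ⟨(mem_skew_iff.1 h2).1, le_rfl⟩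
    exact ((h.lt_iff i j _).1 (hj.trans_lt h3)).2
  · intro i i' j hi h1 h2
    have h3 := (h.ne_zero_iff h0 _).1 h2
    obtain ⟨k, hk⟩ := Nat.exists_eq_succ_of_ne_zero h3
    have h4 := ((h.eq_succ_iff i' j k).1 hk).2
    have h5 : g (k + 1) i' ≤ g (k + 1) (i + 1) :=
      antitone_nat_of_succ_le (hg.anti (k + 1)) hi
    have h6 := ((h.lt_iff i j k).1 (by have := hg.strip k i; omega)).2
    omega
  · intro k
    have h1 := hcount k N
    rw [hg.content k] at h1
    rw [Nat.add_left_cancel h1]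
    congr 1
    refine Finset.filter_congr ?_
    rintro ⟨i, j⟩ hc
    refine (and_iff_right ?_).symm
    by_contra hlt
    have := (mem_skew_iff.1 hc).1
    rw [← hN, hg.supp N i (not_lt.1 hlt)] at this
    omega
  · rintro ⟨i, j⟩ _ k
    have h1 := hg.lattice k i
    rw [hcount (k + 1) (i + 1), hcount k i] at h1
    have h2 : ((nu.cells \ lam.cells).filter (fun c => c.1 < i + 1 ∧ T c = k + 1 + 1)).card ≤
        ((nu.cells \ lam.cells).filter (fun c => c.1 < i ∧ T c = k + 1)).card := by omega
    refine le_trans (Finset.card_le_card ?_) (h2.trans (Finset.card_le_card ?_))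
    · refine Finset.monotone_filter_right _ fun c _ hc => ?_
      exact ⟨by rcases hc.1 with h | h <;> omega, hc.2⟩
    · refine Finset.monotone_filter_right _ fun c _ hc => ?_
      exact ⟨Or.inl hc.1, hc.2⟩

lemma lrCoeff_eq_card {lam mu nu : YoungDiagram} {N : ℕ} (hmu : ∀ k, N ≤ k → mu.rowLen k = 0)
    (hnu : ∀ k, N ≤ k → nu.rowLen k = 0) :
    lrCoeff lam mu nu =
      Nat.card {g // IsPattern N lam.rowLen mu.rowLen g ∧ g N = nu.rowLen} := by
  unfold lrCoeff
  split_ifs with hle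
  · refine Nat.card_eq_of_bijective (fun T => ⟨T.2.exists_encodes.choose,
      T.2.exists_encodes.choose_spec.isPattern T.2 hle hmu hnu⟩) ⟨?_, ?_⟩
    · intro T T' h
      have h1 := T.2.exists_encodes.choose_spec
      rw [Subtype.mk.inj h] at h1
      exact Subtype.ext (h1.left_unique T'.2.exists_encodes.choose_spec)
    · rintro ⟨g, hg, hN⟩
      obtain ⟨T, hT⟩ := hg.exists_encodes hmu hN
      have hLR := hT.isLRTableau hg hN
      exact ⟨⟨T, hLR⟩, Subtype.ext (hLR.exists_encodes.choose_spec.right_unique hT)⟩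
  · symm
    rw [Nat.card_eq_zero]
    left
    refine ⟨fun ⟨g, hg, hN⟩ => hle (le_iff_rowLen_le.2 fun i => ?_)⟩
    rw [← hg.zero, ← hN]
    exact monotone_nat_of_le_succ (fun k => hg.le k i) (Nat.zero_le N)

lemma IsPattern.rowSum_strip {N : ℕ} {lam mu : ℕ → ℕ} {g : ℕ → ℕ → ℕ} (hg : IsPattern N lam mu g)
    (k i : ℕ) (hi : i ≤ k) : rowSum (g (k + 1)) i ≤ rowSum (g k) i := by
  induction k generalizing i with
  | zero =>
    obtain rfl : i = 0 := by omega
    simp [rowSum]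
  | succ k ih =>
    cases i with
    | zero => simp [rowSum]
    | succ i =>
      have h1 : rowSum (g (k + 1 + 1)) (i + 1) + rowSum (g k) i ≤
          rowSum (g (k + 1)) (i + 1) + rowSum (g (k + 1)) i := hg.lattice k i
      have h2 := ih i (by omega)
      omega

lemma IsPattern.content_le {N : ℕ} {lam mu : ℕ → ℕ} {g : ℕ → ℕ → ℕ} (hg : IsPattern N lam mu g)
    (k : ℕ) : mu k ≤ g (k + 1) k := by
  have key : ∀ m, rowSum (g (k + 1)) (k + m) + g (k + 1) (k + m) ≤
      rowSum (g k) (k + m) + g (k + 1) k := by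
    intro m
    induction m with
    | zero => exact Nat.add_le_add_right (hg.rowSum_strip k k le_rfl) _
    | succ m ih =>
      rw [← add_assoc, ChernTensor.rowSum_succ, ChernTensor.rowSum_succ]
      have := hg.strip k (k + m)
      omega
  have h := key N
  rw [hg.rowSum_eq _ (k + N) (by omega), hg.rowSum_eq _ (k + N) (by omega), hg.content] at h
  omega

lemma exists_isPattern_of_lrCoeff_ne_zero {lam mu nu : YoungDiagram} {N : ℕ}
    (hmu : ∀ k, N ≤ k → mu.rowLen k = 0) (hnu : ∀ k, N ≤ k → nu.rowLen k = 0)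
    (h : lrCoeff lam mu nu ≠ 0) :
    ∃ g, IsPattern N lam.rowLen mu.rowLen g ∧ g N = nu.rowLen := by
  rw [lrCoeff_eq_card hmu hnu, Nat.card_ne_zero] at h
  obtain ⟨⟨g, hg⟩⟩ := h.1
  exact ⟨g, hg⟩

lemma rowLen_eq_zero_of_card_le {ν : YoungDiagram} {i : ℕ} (h : ν.card ≤ i) : ν.rowLen i = 0 :=
  rowLen_eq_zero ((colLen_zero_le_card ν).trans h)

lemma of_lrCoeff_ne_zero {lam mu nu : YoungDiagram} (h : lrCoeff lam mu nu ≠ 0) :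
    lam ≤ nu ∧ mu ≤ nu ∧ nu.card = lam.card + mu.card := by
  have hl : ∀ i, lam.card + mu.card + nu.card ≤ i → lam.rowLen i = 0 :=
    fun i hi => rowLen_eq_zero_of_card_le (by omega)
  have hm : ∀ i, lam.card + mu.card + nu.card ≤ i → mu.rowLen i = 0 :=
    fun i hi => rowLen_eq_zero_of_card_le (by omega)
  have hn : ∀ i, lam.card + mu.card + nu.card ≤ i → nu.rowLen i = 0 :=
    fun i hi => rowLen_eq_zero_of_card_le (by omega)
  obtain ⟨g, hg, hN⟩ := exists_isPattern_of_lrCoeff_ne_zero hm hn h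
  have hmono : ∀ i, Monotone fun k => g k i := fun i => monotone_nat_of_le_succ fun k => hg.le k i
  refine ⟨le_iff_rowLen_le.2 fun i => ?_, le_iff_rowLen_le.2 fun i => ?_, ?_⟩
  · rw [← hg.zero, ← hN]
    exact hmono i (Nat.zero_le _)
  · by_cases hi : lam.card + mu.card + nu.card ≤ i
    · rw [hm i hi]
      exact Nat.zero_le _
    · rw [← hN]
      exact (hg.content_le i).trans (hmono i (by omega))
  · rw [← rowSum_rowLen hn, ← hN, hg.rowSum_le, rowSum_rowLen hl, rowSum_rowLen hm]

lemma finite_lrCoeff_ne_zero (lam mu : YoungDiagram) : {nu | lrCoeff lam mu nu ≠ 0}.Finite := by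
  have hm : ∀ i, lam.card + mu.card ≤ i → mu.rowLen i = 0 :=
    fun i hi => rowLen_eq_zero_of_card_le (by omega)
  refine ((finite_isPattern (lam := lam.rowLen) hm).image
    (fun g => Function.invFun YoungDiagram.rowLen (g (lam.card + mu.card)))).subset ?_
  intro nu h
  obtain ⟨g, hg, hN⟩ := exists_isPattern_of_lrCoeff_ne_zero hm
    (fun i hi => rowLen_eq_zero_of_card_le ((of_lrCoeff_ne_zero h).2.2.le.trans hi)) h
  refine ⟨g, hg, ?_⟩
  simp only [hN]
  exact Function.leftInverse_invFun rowLen_injective nu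

theorem sum_lrCoeff_div_hookProd (lam mu : YoungDiagram) :
    ∑ nu ∈ (finite_lrCoeff_ne_zero lam mu).toFinset, (lrCoeff lam mu nu : ℚ) / hookProd nu =
      1 / (hookProd lam * hookProd mu) := by
  set N := lam.card + mu.card with hNdef
  have hl : ∀ i, N ≤ i → lam.rowLen i = 0 := fun i hi => rowLen_eq_zero_of_card_le (by omega)
  have hm : ∀ i, N ≤ i → mu.rowLen i = 0 := fun i hi => rowLen_eq_zero_of_card_le (by omega)
  set A := (finite_isPattern (lam := lam.rowLen) hm).toFinset
  set sh : (ℕ → ℕ → ℕ) → YoungDiagram := fun g => Function.invFun YoungDiagram.rowLen (g N)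
  have hsh : ∀ g ∈ A, (sh g).rowLen = g N := fun g hg => by
    have hg : IsPattern N lam.rowLen mu.rowLen g := (Set.Finite.mem_toFinset _).1 hg
    exact Function.invFun_eq (exists_rowLen_eq (hg.anti N) (hg.supp N))
  have hcard : ∀ nu : YoungDiagram, (∀ i, N ≤ i → nu.rowLen i = 0) →
      lrCoeff lam mu nu = (A.filter (fun g => sh g = nu)).card := by
    intro nu hn
    rw [lrCoeff_eq_card hm hn]
    refine Nat.subtype_card _ fun g => ?_
    rw [Finset.mem_filter]
    constructor
    · rintro ⟨hg, rfl⟩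
      exact ⟨(Set.Finite.mem_toFinset _).1 hg, (hsh g hg).symm⟩
    · rintro ⟨hg, h⟩
      refine ⟨(Set.Finite.mem_toFinset _).2 hg, ?_⟩
      simp only [sh, h]
      exact Function.leftInverse_invFun rowLen_injective nu
  have h1 := patternSum_eq (N := N) (fun s => lam.rowLen_anti _ _ (Nat.le_succ s))
    (fun s => mu.rowLen_anti _ _ (Nat.le_succ s)) hl hm
    (by rw [rowSum_rowLen hl, rowSum_rowLen hm])
  have hdet : ∀ nu : YoungDiagram, nu.card ≤ N → rowDet N nu.rowLen = 1 / hookProd nu :=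
    fun nu h => jacobiTrudi_rowLen nu ((colLen_zero_le_card nu).trans h)
  rw [hdet lam (by omega), hdet mu (by omega), one_div_mul_one_div] at h1
  rw [← h1, patternSum, finsum_mem_eq_finite_toFinset_sum _ (finite_isPattern hm)]
  symm
  rw [← Finset.sum_fiberwise_of_maps_to (t := (finite_lrCoeff_ne_zero lam mu).toFinset) (g := sh)]
  · refine Finset.sum_congr rfl fun nu hnu => ?_
    have hc : nu.card = N := (of_lrCoeff_ne_zero ((Set.Finite.mem_toFinset _).1 hnu)).2.2
    rw [hcard nu fun i hi => rowLen_eq_zero_of_card_le (hc.le.trans hi), div_eq_mul_one_div,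
      ← hdet nu hc.le, ← nsmul_eq_mul, ← Finset.sum_const]
    refine Finset.sum_congr rfl fun g hg => ?_
    rw [← (Finset.mem_filter.1 hg).2, hsh g (Finset.mem_filter.1 hg).1]
  · intro g hg
    refine (Set.Finite.mem_toFinset _).2 ?_
    have hg' : IsPattern N lam.rowLen mu.rowLen g := (Set.Finite.mem_toFinset _).1 hg
    have hn : ∀ i, N ≤ i → (sh g).rowLen i = 0 := by rw [hsh g hg]; exact hg'.supp N
    change lrCoeff lam mu (sh g) ≠ 0
    rw [hcard _ hn]
    exact Finset.card_ne_zero_of_mem (Finset.mem_filter.2 ⟨hg, rfl⟩)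

lemma card_transpose (ν : YoungDiagram) : ν.transpose.card = ν.card := by
  refine Finset.card_bij (fun c _ => c.swap) ?_ ?_ ?_
  · intro c hc
    exact YoungDiagram.mem_transpose.1 hc
  · intro c _ d _ h
    exact Prod.swap_injective h
  · intro c hc
    exact ⟨c.swap, YoungDiagram.mem_transpose.2 (by rwa [Prod.swap_swap]), Prod.swap_swap c⟩

/-- The polynomial `∏ (X + j - i)` over the cells `(i, j)` of a finite set. -/
def contentPolynomial (S : Finset (ℕ × ℕ)) : Polynomial ℚ :=
  ∏ c ∈ S, (Polynomial.X + Polynomial.C ((c.2 : ℚ) - (c.1 : ℚ)))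

lemma contentPolynomial_monic (S : Finset (ℕ × ℕ)) : (contentPolynomial S).Monic :=
  Polynomial.monic_prod_of_monic _ _ fun _ _ => Polynomial.monic_X_add_C _

lemma natDegree_contentPolynomial (S : Finset (ℕ × ℕ)) :
    (contentPolynomial S).natDegree = S.card := by
  rw [contentPolynomial, Polynomial.natDegree_prod_of_monic _ _
    fun _ _ => Polynomial.monic_X_add_C _]
  simp only [Polynomial.natDegree_X_add_C, Finset.sum_const, smul_eq_mul, mul_one]

lemma eval_contentPolynomial (S : Finset (ℕ × ℕ)) (n : ℚ) :
    (contentPolynomial S).eval n = ∏ c ∈ S, (n + (c.2 : ℚ) - (c.1 : ℚ)) := by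
  rw [contentPolynomial, Polynomial.eval_prod]
  refine Finset.prod_congr rfl fun c _ => ?_
  simp
  ring

/-- The bivariate polynomial `p(x₀) q(x₁)`. -/
def prodPoly (p q : Polynomial ℚ) : MvPolynomial (Fin 2) ℚ :=
  Polynomial.aeval (MvPolynomial.X 0) p * Polynomial.aeval (MvPolynomial.X 1) q

lemma eval_prodPoly (p q : Polynomial ℚ) (x : Fin 2 → ℚ) :
    MvPolynomial.eval x (prodPoly p q) = p.eval (x 0) * q.eval (x 1) := by
  have h : ∀ (i : Fin 2) (p : Polynomial ℚ),
      MvPolynomial.eval x (Polynomial.aeval (MvPolynomial.X i) p) = p.eval (x i) := by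
    intro i p
    rw [Polynomial.aeval_eq_sum_range, map_sum, Polynomial.eval_eq_sum_range]
    simp [MvPolynomial.smul_eval]
  rw [prodPoly, map_mul, h, h]

lemma coeff_prodPoly (p q : Polynomial ℚ) (a b : ℕ) :
    MvPolynomial.coeff (Finsupp.single 0 a + Finsupp.single 1 b) (prodPoly p q) =
      p.coeff a * q.coeff b := by
  have h : ∀ (i : Fin 2) (p : Polynomial ℚ), Polynomial.aeval (MvPolynomial.X i) p =
      ∑ k ∈ Finset.range (p.natDegree + 1),
        MvPolynomial.monomial (Finsupp.single i k) (p.coeff k) := by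
    intro i p
    rw [Polynomial.aeval_eq_sum_range]
    refine Finset.sum_congr rfl fun k _ => ?_
    rw [MvPolynomial.X_pow_eq_monomial, MvPolynomial.smul_monomial, smul_eq_mul, mul_one]
  have hinj : ∀ k l : ℕ, (Finsupp.single (0 : Fin 2) k + Finsupp.single 1 l =
      Finsupp.single 0 a + Finsupp.single 1 b) ↔ k = a ∧ l = b := by
    intro k l
    constructor
    · intro e
      have e0 := DFunLike.congr_fun e 0
      have e1 := DFunLike.congr_fun e 1
      simp at e0 e1
      exact ⟨e0, e1⟩
    · rintro ⟨rfl, rfl⟩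
      rfl
  have hz : ∀ (p : Polynomial ℚ) (a : ℕ),
      (∑ k ∈ Finset.range (p.natDegree + 1), if k = a then p.coeff k else 0) = p.coeff a := by
    intro p a
    rw [Finset.sum_ite_eq']
    split_ifs with ha
    · rfl
    · exact (Polynomial.coeff_eq_zero_of_natDegree_lt
        (by rw [Finset.mem_range] at ha; omega)).symm
  rw [prodPoly, h, h, Finset.sum_mul_sum, MvPolynomial.coeff_sum, ← hz p a, ← hz q b,
    Finset.sum_mul_sum]
  refine Finset.sum_congr rfl fun k _ => ?_
  rw [MvPolynomial.coeff_sum]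
  refine Finset.sum_congr rfl fun l _ => ?_
  rw [MvPolynomial.monomial_mul, MvPolynomial.coeff_monomial]
  simp only [hinj]
  split_ifs <;> simp_all

lemma degreeOf_aeval_X_le (i j : Fin 2) (p : Polynomial ℚ) :
    MvPolynomial.degreeOf i (Polynomial.aeval (MvPolynomial.X j : MvPolynomial (Fin 2) ℚ) p) ≤
      if i = j then p.natDegree else 0 := by
  rw [Polynomial.aeval_eq_sum_range]
  refine (MvPolynomial.degreeOf_sum_le _ _ _).trans (Finset.sup_le fun k hk => ?_)
  rw [MvPolynomial.smul_eq_C_mul]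
  refine (MvPolynomial.degreeOf_C_mul_le _ _ _).trans ?_
  refine (MvPolynomial.degreeOf_pow_le _ _ _).trans ?_
  rw [MvPolynomial.degreeOf_X]
  have := Finset.mem_range.1 hk
  split_ifs <;> omega

lemma degreeOf_zero_prodPoly (p q : Polynomial ℚ) :
    MvPolynomial.degreeOf 0 (prodPoly p q) ≤ p.natDegree := by
  refine (MvPolynomial.degreeOf_mul_le _ _ _).trans ?_
  have h1 := degreeOf_aeval_X_le 0 0 p
  have h2 := degreeOf_aeval_X_le 0 1 q
  simp only [if_true, zero_ne_one, if_false] at h1 h2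
  omega

lemma degreeOf_one_prodPoly (p q : Polynomial ℚ) :
    MvPolynomial.degreeOf 1 (prodPoly p q) ≤ q.natDegree := by
  refine (MvPolynomial.degreeOf_mul_le _ _ _).trans ?_
  have h1 := degreeOf_aeval_X_le 1 0 p
  have h2 := degreeOf_aeval_X_le 1 1 q
  simp only [if_true, one_ne_zero, if_false] at h1 h2
  omega

/-- `P_{λ,μ}` is a polynomial of degree `|μ|` in `e`, `|λ|` in `f`, with
leading coefficient `1/(h(λ)h(μ))` on the monomial `e^{|μ|} f^{|λ|}`. -/
theorem P_leading_term (lam mu : YoungDiagram) :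
    ∃ Q : MvPolynomial (Fin 2) ℚ,
      (∀ e f : ℚ, MvPolynomial.eval (fun i => if i = 0 then e else f) Q = P lam mu e f) ∧
      MvPolynomial.degreeOf 0 Q = mu.card ∧
      MvPolynomial.degreeOf 1 Q = lam.card ∧
      MvPolynomial.coeff (Finsupp.single 0 mu.card + Finsupp.single 1 lam.card) Q =
        1 / (hookProd lam * hookProd mu) := by
  have hB : ∀ κ ∈ (finite_lrCoeff_ne_zero lam.transpose mu).toFinset,
      (κ.transpose.cells \ lam.cells).card = mu.card ∧ (κ.cells \ mu.cells).card = lam.card := by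
    intro κ hκ
    obtain ⟨h1, h2, h3⟩ := of_lrCoeff_ne_zero ((Set.Finite.mem_toFinset _).1 hκ)
    have h1' : lam ≤ κ.transpose := by
      rwa [← YoungDiagram.transpose_le_iff, YoungDiagram.transpose_transpose]
    have h4 := card_transpose κ
    rw [card_transpose] at h3
    rw [Finset.card_sdiff_of_subset (YoungDiagram.cells_subset_iff.2 h1'),
      Finset.card_sdiff_of_subset (YoungDiagram.cells_subset_iff.2 h2)]
    unfold YoungDiagram.card at *
    omega
  have hcoeff : MvPolynomial.coeff (Finsupp.single 0 mu.card + Finsupp.single 1 lam.card)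
      (∑ κ ∈ (finite_lrCoeff_ne_zero lam.transpose mu).toFinset,
        MvPolynomial.C ((lrCoeff lam.transpose mu κ : ℚ) / hookProd κ) *
          prodPoly (contentPolynomial (κ.transpose.cells \ lam.cells))
            (contentPolynomial (κ.cells \ mu.cells))) = 1 / (hookProd lam * hookProd mu) := by
    rw [← hookProd_transpose lam, ← sum_lrCoeff_div_hookProd, MvPolynomial.coeff_sum]
    refine Finset.sum_congr rfl fun κ hκ => ?_
    have h1 := contentPolynomial_monic (κ.transpose.cells \ lam.cells)
    have h2 := contentPolynomial_monic (κ.cells \ mu.cells)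
    rw [Polynomial.Monic, Polynomial.leadingCoeff, natDegree_contentPolynomial] at h1 h2
    rw [MvPolynomial.coeff_C_mul, coeff_prodPoly]
    rw [(hB κ hκ).1] at h1
    rw [(hB κ hκ).2] at h2
    rw [h1, h2, mul_one, mul_one]
  have hne : (1 : ℚ) / (hookProd lam * hookProd mu) ≠ 0 :=
    one_div_ne_zero (mul_ne_zero (hookProd_ne_zero lam) (hookProd_ne_zero mu))
  have hmem := MvPolynomial.mem_support_iff.2 (hcoeff ▸ hne)
  refine ⟨_, ?_, le_antisymm ?_ ?_, le_antisymm ?_ ?_, hcoeff⟩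
  · intro e f
    rw [P, finsum_eq_sum_of_support_subset (s := (finite_lrCoeff_ne_zero lam.transpose
      mu).toFinset.image YoungDiagram.transpose), Finset.sum_image, map_sum]
    · refine Finset.sum_congr rfl fun κ _ => ?_
      rw [map_mul, MvPolynomial.eval_C, eval_prodPoly, eval_contentPolynomial,
        eval_contentPolynomial, YoungDiagram.transpose_transpose, hookProd_transpose]
      simp only [if_true, skewContPoly, one_ne_zero, if_false]
      ring
    · intro κ _ κ' _ h
      exact YoungDiagram.transpose_eq_iff.1 h
    · intro nu hnu
      rw [Finset.coe_image]
      refine ⟨nu.transpose, (Set.Finite.mem_toFinset _).2 fun h0 => hnu ?_,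
        YoungDiagram.transpose_transpose nu⟩
      simp only [h0, Nat.cast_zero, zero_mul, zero_div]
  · refine (MvPolynomial.degreeOf_sum_le _ _ _).trans (Finset.sup_le fun κ hκ => ?_)
    refine (MvPolynomial.degreeOf_C_mul_le _ _ _).trans ((degreeOf_zero_prodPoly _ _).trans ?_)
    rw [natDegree_contentPolynomial, (hB κ hκ).1]
  · simpa using MvPolynomial.monomial_le_degreeOf 0 hmem
  · refine (MvPolynomial.degreeOf_sum_le _ _ _).trans (Finset.sup_le fun κ hκ => ?_)
    refine (MvPolynomial.degreeOf_C_mul_le _ _ _).trans ((degreeOf_one_prodPoly _ _).trans ?_)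
    rw [natDegree_contentPolynomial, (hB κ hκ).2]
  · simpa using MvPolynomial.monomial_le_degreeOf 1 hmem

end ChernTensor
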